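/- arXiv:2510.09562 — 2 statements merged into one kernel-verified Lean document; each statement's English description precedes it below -/
import Mathlib

section
/- On a probability space, let X₁, X₂, … be nonnegative random variables with common survival function P(Xᵢ > x) = x^{-α} l(x) for all x > 0, where α ∈ (0,1) and l is slowly varying at infinity, and suppose Condition A(1) holds. (i) If for some a > 0, ∑_{1≤i,j≤n, i≠j} Cov(1(Xᵢ ≤ a), 1(Xⱼ ≤ a)) = o(n²), then for every h > 0, log M⁻_{n,h}/log M_{n,1} − h = O_p(1/log n). (ii) If for some δ' > 2(1/α − 1), setting b_n := d_{n,1}/c_n^{2δ'}, one has ∑_{1≤i,j≤n, i≠j} Cov(1(Xᵢ ≤ b_n), 1(Xⱼ ≤ b_n)) = o(n²), then for every h > 0, M⁻_{n,h}/M_{n,1}^h →p 1 as n → ∞. -/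
open MeasureTheory Filter

noncomputable section

/-- `l` is slowly varying at infinity: for every `lam > 0`, `l(lam*x)/l(x) → 1` as `x → ∞`. -/
def SlowlyVarying (l : ℝ → ℝ) : Prop :=
  ∀ lam : ℝ, 0 < lam → Tendsto (fun x => l (lam * x) / l x) atTop (nhds 1)

/-- Covariance `Cov(U,V) = E[UV] - E[U]E[V]`. -/
def cov {Ω : Type*} [MeasurableSpace Ω] (μ : Measure Ω) (U V : Ω → ℝ) : ℝ :=
  (∫ ω, U ω * V ω ∂μ) - (∫ ω, U ω ∂μ) * (∫ ω, V ω ∂μ)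

/-- Truncation `X·1(X < t)`. -/
def trunc {Ω : Type*} (X : Ω → ℝ) (t : ℝ) : Ω → ℝ :=
  fun ω => if X ω < t then X ω else 0

/-- Sum of covariances of `p`-th powers of the variables truncated at `v n`,
over distinct pairs of indices among the first `n`. -/
def covSum {Ω : Type*} [MeasurableSpace Ω] (μ : Measure Ω) (X : ℕ → Ω → ℝ)
    (v : ℕ → ℝ) (p : ℝ) (n : ℕ) : ℝ :=
  ∑ i ∈ Finset.range n, ∑ j ∈ Finset.range n,
    if i = j then 0
    else cov μ (fun ω => trunc (X i) (v n) ω ^ p) (fun ω => trunc (X j) (v n) ω ^ p)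

/-- Condition A(p). -/
def ConditionA {Ω : Type*} [MeasurableSpace Ω] (μ : Measure Ω) (X : ℕ → Ω → ℝ)
    (v c : ℕ → ℝ) (p : ℝ) : Prop :=
  Tendsto (fun n => covSum μ X v p n / (v n ^ (2 * p) * c n ^ 2)) atTop (nhds 0)

/-- `p`-th sample moment `M_{n,p}`. -/
def sampleMoment {Ω : Type*} (X : ℕ → Ω → ℝ) (p : ℝ) (n : ℕ) (ω : Ω) : ℝ :=
  (n : ℝ)⁻¹ * ∑ i ∈ Finset.range n, X i ω ^ p

/-- `Y_n = O_p(r_n)`. -/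
def IsOp {Ω : Type*} [MeasurableSpace Ω] (μ : Measure Ω) (Y : ℕ → Ω → ℝ) (r : ℕ → ℝ) : Prop :=
  ∀ ε : ℝ, 0 < ε → ∃ C : ℝ, 0 < C ∧
    ∀ᶠ n in atTop, (μ {ω | C * r n < |Y n ω|}).toReal < ε

/-- Convergence in probability to a constant. -/
def TendstoInProbability {Ω : Type*} [MeasurableSpace Ω] (μ : Measure Ω)
    (Y : ℕ → Ω → ℝ) (a : ℝ) : Prop :=
  ∀ ε : ℝ, 0 < ε → Tendsto (fun n => (μ {ω | ε < |Y n ω - a|}).toReal) atTop (nhds 0)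

/-- `h`-th sample central lower moment `M⁻_{n,h}`. -/
def lowerMoment {Ω : Type*} (X : ℕ → Ω → ℝ) (h : ℝ) (n : ℕ) (ω : Ω) : ℝ :=
  (n : ℝ)⁻¹ * ∑ i ∈ Finset.range n, max (sampleMoment X 1 n ω - X i ω) 0 ^ h

lemma aux_tail_lower (F : ℝ → ℝ) (hpos : ∀ x, 0 < x → 0 < F x)
    (hanti : ∀ x y, 0 < x → x ≤ y → F y ≤ F x) (β : ℝ) (hβ : 0 < β)
    (h2 : ∀ᶠ x in atTop, (2:ℝ) ^ (-β) * F x ≤ F (2 * x)) :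
    ∃ C : ℝ, 0 < C ∧ ∃ x0 : ℝ, 0 < x0 ∧ ∀ x, x0 ≤ x → C ≤ F x * x ^ β := by
  obtain ⟨y, hy⟩ := eventually_atTop.1 h2
  set x0 := max y 1 with hx0
  have hx0pos : 0 < x0 := lt_of_lt_of_le one_pos (le_max_right _ _)
  refine ⟨F (2 * x0) * x0 ^ β, mul_pos (hpos _ (by positivity)) (by positivity), x0, hx0pos, ?_⟩
  have key : ∀ n : ℕ, ∀ x, x0 ≤ x → x ≤ 2 ^ (n+1) * x0 → F (2 * x0) * x0 ^ β ≤ F x * x ^ β := by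
    intro n
    have base : ∀ x, x0 ≤ x → x ≤ 2 * x0 → F (2 * x0) * x0 ^ β ≤ F x * x ^ β := by
      intro x hx hx'
      have hxp : 0 < x := hx0pos.trans_le hx
      apply mul_le_mul (hanti _ _ hxp hx') (Real.rpow_le_rpow hx0pos.le hx hβ.le) (by positivity)
        (hpos _ hxp).le
    induction n with
    | zero => intro x hx hx'; exact base x hx (by simpa using hx')
    | succ n ih =>
      intro x hx hx'
      by_cases hc : x ≤ 2 * x0
      · exact base x hx hc
      · push Not at hc
        have hxp : 0 < x := hx0pos.trans_le hx
        have h1 := ih (x/2) (by linarith) (by rw [pow_succ] at hx'; linarith)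
        have h3 := hy (x/2) (by have := le_max_left y 1; rw [← hx0] at this; linarith)
        rw [show 2 * (x/2) = x by ring] at h3
        refine h1.trans ?_
        rw [Real.div_rpow hxp.le (by norm_num)]
        rw [Real.rpow_neg (by norm_num)] at h3
        calc F (x/2) * (x ^ β / 2 ^ β) = ((2 ^ β)⁻¹ * F (x/2)) * x ^ β := by ring
          _ ≤ _ := by gcongr
  intro x hx
  obtain ⟨n, hn⟩ := pow_unbounded_of_one_lt (x / x0) (one_lt_two)
  refine key n x hx ?_
  rw [div_lt_iff₀ hx0pos] at hn
  refine hn.le.trans ?_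
  gcongr
  · norm_num
  · omega

lemma aux_trunc_meas {Ω : Type*} [MeasurableSpace Ω] (Y : Ω → ℝ) (hY : Measurable Y) (x : ℝ) :
    Measurable (trunc Y x) := by
  unfold trunc
  exact Measurable.ite (measurableSet_lt hY measurable_const) hY measurable_const

lemma aux_trunc_nonneg {Ω : Type*} (Y : Ω → ℝ) (hY : ∀ ω, 0 ≤ Y ω) (x : ℝ) (ω : Ω) :
    0 ≤ trunc Y x ω := by
  unfold trunc; split_ifs <;> simp [hY]

lemma aux_trunc_le {Ω : Type*} (Y : Ω → ℝ) (x : ℝ) (hx : 0 < x) (ω : Ω) :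
    trunc Y x ω ≤ x := by
  unfold trunc; split_ifs with h
  · exact h.le
  · exact hx.le

lemma aux_trunc_le_self {Ω : Type*} (Y : Ω → ℝ) (hY : ∀ ω, 0 ≤ Y ω) (x : ℝ) (ω : Ω) :
    trunc Y x ω ≤ Y ω := by
  unfold trunc; split_ifs with h <;> simp [hY]

lemma aux_trunc_memLp {Ω : Type*} [MeasurableSpace Ω] (μ : Measure Ω) [IsProbabilityMeasure μ]
    (Y : Ω → ℝ) (hYm : Measurable Y) (hY : ∀ ω, 0 ≤ Y ω) (x : ℝ) (hx : 0 < x) (p : ENNReal) :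
    MemLp (trunc Y x) p μ := by
  refine MemLp.of_bound (aux_trunc_meas Y hYm x).aestronglyMeasurable x (ae_of_all _ fun ω => ?_)
  rw [Real.norm_of_nonneg (aux_trunc_nonneg Y hY x ω)]
  exact aux_trunc_le Y x hx ω

/-- lower bound for the truncated mean -/
lemma aux_mean_lower {Ω : Type*} [MeasurableSpace Ω] (μ : Measure Ω) [IsProbabilityMeasure μ]
    (Y : Ω → ℝ) (hYm : Measurable Y) (hY : ∀ ω, 0 ≤ Y ω) (x : ℝ) (hx : 0 < x) :
    x / 4 * ((μ {ω | x / 4 < Y ω}).toReal - (μ {ω | x / 2 < Y ω}).toReal) ≤ ∫ ω, trunc Y x ω ∂μ := by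
  have m4 : MeasurableSet {ω | x / 4 < Y ω} := measurableSet_lt measurable_const hYm
  have m2 : MeasurableSet {ω | x / 2 < Y ω} := measurableSet_lt measurable_const hYm
  have hsub : {ω | x / 2 < Y ω} ⊆ {ω | x / 4 < Y ω} := by
    intro ω hω
    rw [Set.mem_ofPred_eq] at hω ⊢
    linarith
  have hd : (μ {ω | x / 4 < Y ω}).toReal - (μ {ω | x / 2 < Y ω}).toReal
      = μ.real ({ω | x / 4 < Y ω} \ {ω | x / 2 < Y ω}) := by
    rw [measureReal_sdiff hsub m2]; rfl
  rw [hd]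
  have hm := mul_meas_ge_le_integral_of_nonneg (μ := μ) (f := trunc Y x)
    (ae_of_all _ (aux_trunc_nonneg Y hY x))
    ((aux_trunc_memLp μ Y hYm hY x hx 1).integrable le_rfl) (x / 4)
  refine le_trans ?_ hm
  apply mul_le_mul_of_nonneg_left _ (by positivity)
  refine measureReal_mono ?_
  rintro ω ⟨h1, h2⟩
  simp only [Set.mem_ofPred_eq, not_lt] at h1 h2 ⊢
  unfold trunc
  rw [if_pos (by linarith)]
  exact h1.le

/-- Chebyshev step -/
lemma aux_cheb {Ω : Type*} [MeasurableSpace Ω] (μ : Measure Ω) [IsProbabilityMeasure μ]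
    (X : ℕ → Ω → ℝ) (hXm : ∀ i, Measurable (X i)) (hX : ∀ i ω, 0 ≤ X i ω)
    (v : ℕ → ℝ) (n : ℕ) (hv : 0 < v n) (e : ℝ) (he : 0 < e)
    (hE : e ≤ ∑ i ∈ Finset.range n, ∫ ω, trunc (X i) (v n) ω ∂μ) :
    (μ {ω | ∑ i ∈ Finset.range n, X i ω < e / 2}).toReal ≤
      4 * (|covSum μ X v 1 n| / e ^ 2 + v n / e) := by
  set Y : ℕ → Ω → ℝ := fun i => trunc (X i) (v n) with hYdef
  have hmem : ∀ i, MemLp (Y i) 2 μ := fun i => aux_trunc_memLp μ _ (hXm i) (hX i) _ hv 2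
  have hint : ∀ i, Integrable (Y i) μ := fun i =>
    (aux_trunc_memLp μ _ (hXm i) (hX i) _ hv 1).integrable le_rfl
  set S : Ω → ℝ := fun ω => ∑ i ∈ Finset.range n, Y i ω with hS
  set m := ∑ i ∈ Finset.range n, ∫ ω, Y i ω ∂μ with hm
  have hSmem : MemLp S 2 μ := memLp_finsetSum _ (fun i _ => hmem i)
  have hSint : ∫ ω, S ω ∂μ = m := integral_finsetSum _ (fun i _ => hint i)
  have hmpos : 0 < m := he.trans_le hE
  have hch := ProbabilityTheory.meas_ge_le_variance_div_sq hSmem (c := m / 2) (by positivity)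
  have hvar : ProbabilityTheory.variance S μ ≤ |covSum μ X v 1 n| + v n * m := by
    rw [hS, ProbabilityTheory.variance_fun_sum' (fun i _ => hmem i)]
    have hdec : ∀ i ∈ Finset.range n, ∑ j ∈ Finset.range n, ProbabilityTheory.covariance (Y i) (Y j) μ
        ≤ (∑ j ∈ Finset.range n, if i = j then 0
        else cov μ (fun ω => trunc (X i) (v n) ω ^ (1:ℝ)) (fun ω => trunc (X j) (v n) ω ^ (1:ℝ)))
          + v n * ∫ ω, Y i ω ∂μ := by
      intro i hi
      have : v n * ∫ ω, Y i ω ∂μ = ∑ j ∈ Finset.range n, if i = j then v n * ∫ ω, Y i ω ∂μ else 0 := by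
        rw [Finset.sum_ite_eq, if_pos hi]
      rw [this, ← Finset.sum_add_distrib]
      apply Finset.sum_le_sum
      intro j _
      by_cases hij : i = j
      · subst hij
        simp only [if_true, zero_add]
        rw [ProbabilityTheory.covariance_eq_sub (hmem i) (hmem i)]
        have h1 : ∫ ω, (Y i * Y i) ω ∂μ ≤ ∫ ω, v n * Y i ω ∂μ := by
          apply integral_mono ((hmem i).integrable_mul (hmem i)) ((hint i).const_mul _)
          intro ω
          exact mul_le_mul_of_nonneg_right (aux_trunc_le _ _ hv ω) (aux_trunc_nonneg _ (hX i) _ ω)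
        rw [integral_const_mul] at h1
        nlinarith [mul_self_nonneg (∫ ω, Y i ω ∂μ)]
      · simp only [if_neg hij, add_zero]
        rw [ProbabilityTheory.covariance_eq_sub (hmem i) (hmem j)]
        simp [cov, hYdef]
    calc _ ≤ _ := Finset.sum_le_sum hdec
      _ = covSum μ X v 1 n + v n * m := by
        rw [Finset.sum_add_distrib, ← Finset.mul_sum]; rfl
      _ ≤ _ := by gcongr; exact le_abs_self _
  have hle : (μ {ω | ∑ i ∈ Finset.range n, X i ω < e / 2}).toReal ≤
      ProbabilityTheory.variance S μ / (m / 2) ^ 2 := by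
    refine ENNReal.toReal_le_of_le_ofReal
      (div_nonneg (ProbabilityTheory.variance_nonneg _ _) (by positivity)) (le_trans ?_ hch)
    apply measure_mono
    intro ω hω
    simp only [Set.mem_ofPred_eq] at hω ⊢
    rw [hSint]
    have : S ω ≤ ∑ i ∈ Finset.range n, X i ω :=
      Finset.sum_le_sum fun i _ => aux_trunc_le_self _ (hX i) _ ω
    rw [abs_sub_comm]
    exact le_trans (by linarith) (le_abs_self _)
  refine hle.trans ?_
  calc ProbabilityTheory.variance S μ / (m / 2) ^ 2
      ≤ (|covSum μ X v 1 n| + v n * m) / (m / 2) ^ 2 := by gcongr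
    _ = 4 * (|covSum μ X v 1 n| / m ^ 2 + v n / m) := by field_simp; norm_num
    _ ≤ _ := by gcongr

/-- deterministic step -/
lemma aux_det {Ω : Type*} (X : ℕ → Ω → ℝ) (hX : ∀ i ω, 0 ≤ X i ω) (n : ℕ) (hn : 0 < n) (ω : Ω)
    (h : ℝ) (hh : 0 < h) (m δ : ℝ) (hm : 0 < m) (hδ : 0 < δ) (hδ1 : δ < 1)
    (hM : m ≤ sampleMoment X 1 n ω)
    (hfrac : ∑ i ∈ Finset.range n, (if δ * m < X i ω then (1:ℝ) else 0) ≤ δ * n) :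
    (1 - δ) * (1 - δ) ^ h ≤ lowerMoment X h n ω / sampleMoment X 1 n ω ^ h ∧
    lowerMoment X h n ω / sampleMoment X 1 n ω ^ h ≤ 1 := by
  unfold lowerMoment
  set M := sampleMoment X 1 n ω
  have hMp : 0 < M := hm.trans_le hM
  have hn' : (0:ℝ) < n := by exact_mod_cast hn
  have hMh : 0 < M ^ h := by positivity
  constructor
  · rw [le_div_iff₀ hMh, ← div_eq_inv_mul, le_div_iff₀ hn']
    have : ∀ i ∈ Finset.range n, (1 - (if δ * m < X i ω then (1:ℝ) else 0)) * ((1 - δ) ^ h * M ^ h)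
        ≤ max (M - X i ω) 0 ^ h := by
      intro i _
      split_ifs with hi
      · simp; positivity
      · push Not at hi
        rw [← Real.mul_rpow (by linarith) hMp.le]
        simp only [sub_zero, one_mul]
        apply Real.rpow_le_rpow (mul_nonneg (by linarith) hMp.le) _ hh.le
        refine le_trans ?_ (le_max_left _ _)
        have : δ * m ≤ δ * M := by gcongr
        linarith
    refine le_trans ?_ (Finset.sum_le_sum this)
    rw [← Finset.sum_mul, Finset.sum_sub_distrib]
    simp only [Finset.sum_const, Finset.card_range, nsmul_eq_mul, mul_one]
    have hp : 0 ≤ (1 - δ) ^ h * M ^ h := mul_nonneg (Real.rpow_nonneg (by linarith) _) hMh.le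
    calc (1 - δ) * (1 - δ) ^ h * M ^ h * n = (n - δ * n) * ((1 - δ) ^ h * M ^ h) := by ring
      _ ≤ _ := by gcongr
  · rw [div_le_one hMh, ← div_eq_inv_mul, div_le_iff₀ hn']
    have : ∀ i ∈ Finset.range n, max (M - X i ω) 0 ^ h ≤ M ^ h := by
      intro i _
      apply Real.rpow_le_rpow (le_max_right _ _) _ hh.le
      exact max_le (by linarith [hX i ω]) hMp.le
    refine (Finset.sum_le_sum this).trans ?_
    simp [mul_comm]

lemma aux_ratio (α : ℝ) (l : ℝ → ℝ) (hlpos : ∀ x : ℝ, 0 < x → 0 < l x) (hl : SlowlyVarying l)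
    (lam : ℝ) (hlam : 0 < lam) :
    Tendsto (fun x : ℝ => ((lam * x) ^ (-α) * l (lam * x)) / (x ^ (-α) * l x)) atTop
      (nhds (lam ^ (-α))) := by
  have h := (hl lam hlam).const_mul (lam ^ (-α))
  rw [mul_one] at h
  refine h.congr' ?_
  filter_upwards [eventually_gt_atTop 0] with x hx
  rw [Real.mul_rpow hlam.le hx.le]
  have := (Real.rpow_pos_of_pos hx (-α)).ne'
  have := (hlpos x hx).ne'
  field_simp

set_option maxHeartbeats 1000000 in
lemma aux_core {Ω : Type*} [MeasurableSpace Ω] (μ : Measure Ω) [IsProbabilityMeasure μ]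
    (X : ℕ → Ω → ℝ) (hXmeas : ∀ i, Measurable (X i)) (hXnn : ∀ i ω, 0 ≤ X i ω)
    (α : ℝ) (hα : 0 < α) (hα1 : α < 1)
    (l : ℝ → ℝ) (hlpos : ∀ x : ℝ, 0 < x → 0 < l x) (hl : SlowlyVarying l)
    (hsurv : ∀ i, ∀ x : ℝ, 0 < x → (μ {ω | x < X i ω}).toReal = x ^ (-α) * l x)
    (c : ℕ → ℝ) (hc : ∀ n, 0 < c n) (hctop : Tendsto c atTop atTop)
    (hclog : Tendsto (fun n : ℕ => Real.log (c n) / Real.log n) atTop (nhds 0))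
    (v : ℕ → ℝ) (hvpos : ∀ n, 0 < v n)
    (hv : Tendsto (fun n : ℕ => (n : ℝ) * l (v n) / (v n ^ α * c n)) atTop (nhds 1))
    (hA1 : ConditionA μ X v c 1) :
    ∃ κ : ℝ, 0 < κ ∧ Tendsto (fun n : ℕ =>
      (μ {ω | sampleMoment X 1 n ω < (n:ℝ) ^ κ}).toReal) atTop (nhds 0) := by
  set F : ℝ → ℝ := fun x => x ^ (-α) * l x with hF
  have hFpos : ∀ x, 0 < x → 0 < F x := fun x hx =>
    mul_pos (Real.rpow_pos_of_pos hx _) (hlpos x hx)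
  have hFanti : ∀ x y, 0 < x → x ≤ y → F y ≤ F x := by
    intro x y hx hxy
    simp only [hF]
    rw [← hsurv 0 x hx, ← hsurv 0 y (hx.trans_le hxy)]
    refine measureReal_mono ?_
    intro ω hω
    rw [Set.mem_ofPred_eq] at hω ⊢
    linarith
  have hrat := aux_ratio α l hlpos hl
  -- tail lower bound
  set β : ℝ := (α + 1) / 2 with hβ
  have hβ0 : 0 < β := by positivity
  have hβ1 : β < 1 := by rw [hβ]; linarith
  have hαβ : α < β := by rw [hβ]; linarith
  obtain ⟨C, hC, x0, hx0, hCx⟩ := aux_tail_lower F hFpos hFanti β hβ0 (by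
    have h2 : (2:ℝ) ^ (-β) < 2 ^ (-α) := Real.rpow_lt_rpow_of_exponent_lt (by norm_num) (by linarith)
    filter_upwards [(hrat 2 (by norm_num)).eventually_const_lt h2, eventually_gt_atTop 0] with x hx hx'
    rw [lt_div_iff₀ (hFpos x hx')] at hx
    exact hx.le)
  -- mean lower bound
  have hmean : ∃ k : ℝ, 0 < k ∧ ∀ᶠ x in atTop, ∀ i, x * k * F x ≤ ∫ ω, trunc (X i) x ω ∂μ := by
    have hlim := (hrat (1/4) (by norm_num)).sub (hrat (1/2) (by norm_num))
    set K : ℝ := (1/4 : ℝ) ^ (-α) - (1/2 : ℝ) ^ (-α) with hK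
    have hKpos : 0 < K := by
      rw [hK, sub_pos]
      exact Real.rpow_lt_rpow_of_neg (by norm_num) (by norm_num) (by linarith)
    refine ⟨K / 8, by positivity, ?_⟩
    filter_upwards [hlim.eventually_const_lt (show K / 2 < K by linarith), eventually_gt_atTop 0]
      with x hx hx' i
    refine le_trans ?_ (aux_mean_lower μ (X i) (hXmeas i) (hXnn i) x hx')
    rw [hsurv i _ (by positivity), hsurv i _ (by positivity)]
    rw [← sub_div, lt_div_iff₀ (hFpos x hx'), one_div_mul_eq_div, one_div_mul_eq_div] at hx
    calc x * (K / 8) * F x = x / 4 * (K / 2 * F x) := by ring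
      _ ≤ _ := by gcongr
  obtain ⟨k, hk, hkx⟩ := hmean
  -- asymptotics of v
  have hv' : Tendsto (fun n : ℕ => (n : ℝ) * F (v n) / c n) atTop (nhds 1) := by
    refine hv.congr fun n => ?_
    simp only [hF]
    rw [Real.rpow_neg (hvpos n).le]
    field_simp
  set η : ℝ := (1 - β) / 5 with hη
  have hη0 : 0 < η := by rw [hη]; linarith
  have hlogn : Tendsto (fun n : ℕ => Real.log n) atTop atTop :=
    Real.tendsto_log_atTop.comp tendsto_natCast_atTop_atTop
  have hlogc : ∀ᶠ n : ℕ in atTop, |Real.log (c n)| ≤ η * Real.log n := by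
    have := (hclog.abs).eventually_lt_const (show |(0:ℝ)| < η by simpa using hη0)
    filter_upwards [this, hlogn.eventually_gt_atTop 0] with n hn hn'
    rw [abs_div, abs_of_pos hn', div_lt_iff₀ hn'] at hn
    exact hn.le
  have hup : ∀ᶠ n : ℕ in atTop, (n : ℝ) * F (v n) ≤ 2 * c n := by
    filter_upwards [hv'.eventually_lt_const (show (1:ℝ) < 2 by norm_num)] with n hn
    rw [div_lt_iff₀ (hc n)] at hn
    exact hn.le
  have hlo : ∀ᶠ n : ℕ in atTop, c n / 2 ≤ (n : ℝ) * F (v n) := by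
    filter_upwards [hv'.eventually_const_lt (show (1/2:ℝ) < 1 by norm_num)] with n hn
    rw [lt_div_iff₀ (hc n)] at hn
    linarith
  have hvtop : Tendsto v atTop atTop := by
    rw [tendsto_atTop]
    intro A
    set B := max A 1
    have hB : 0 < B := lt_of_lt_of_le one_pos (le_max_right _ _)
    filter_upwards [hup, hlogc, hlogn.eventually_gt_atTop ((Real.log 2 - Real.log (F B)) / (1 - η)),
      eventually_gt_atTop 0] with n h1 h2 h3 h4
    by_contra hlt
    push Not at hlt
    have hn0 : (0:ℝ) < n := by exact_mod_cast h4
    have h5 : F B ≤ F (v n) := hFanti _ _ (hvpos n) (hlt.le.trans (le_max_left _ _))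
    have h6 : (n:ℝ) * F B ≤ 2 * c n := le_trans (by gcongr) h1
    have h7 := Real.log_le_log (mul_pos hn0 (hFpos B hB)) h6
    rw [Real.log_mul hn0.ne' (hFpos B hB).ne', Real.log_mul two_ne_zero (hc n).ne'] at h7
    rw [div_lt_iff₀ (by linarith)] at h3
    have := (abs_le.1 h2).2
    nlinarith
  set q : ℝ := k / 2 with hq
  have hq0 : 0 < q := by positivity
  have hmain : ∀ᶠ n : ℕ in atTop, (μ {ω | sampleMoment X 1 n ω < (n:ℝ) ^ η}).toReal ≤
      4 * (|covSum μ X v 1 n / (v n ^ (2 * (1:ℝ)) * c n ^ 2)| / q ^ 2 + 1 / q * (c n)⁻¹) := by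
    filter_upwards [hup, hlo, hlogc, hvtop.eventually hkx, hvtop.eventually_ge_atTop x0,
      eventually_gt_atTop 0, hlogn.eventually_gt_atTop ((Real.log 2 - Real.log C) / η),
      hlogn.eventually_gt_atTop (- Real.log (q / 2) / η)] with n h1 h2 h3 h4 h5 h6 h7 h8
    have hn0 : (0:ℝ) < n := by exact_mod_cast h6
    have hvn := hvpos n
    have hcn := hc n
    have hE : q * v n * c n ≤ ∑ i ∈ Finset.range n, ∫ ω, trunc (X i) (v n) ω ∂μ := by
      calc q * v n * c n = v n * k * (c n / 2) := by rw [hq]; ring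
        _ ≤ v n * k * (n * F (v n)) := by gcongr
        _ = ∑ i ∈ Finset.range n, (v n * k * F (v n)) := by simp; ring
        _ ≤ _ := Finset.sum_le_sum fun i _ => h4 i
    have hch := aux_cheb μ X hXmeas hXnn v n hvn (q * v n * c n) (by positivity) hE
    have hgrow : (n:ℝ) * (n:ℝ) ^ η ≤ q * v n * c n / 2 := by
      rw [← Real.log_le_log_iff (by positivity) (by positivity)]
      rw [show q * v n * c n / 2 = (q / 2) * v n * c n by ring,
        Real.log_mul (by positivity) (by positivity), Real.log_mul (by positivity) (by positivity),
        Real.log_mul (by positivity) (by positivity), Real.log_rpow hn0]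
      have h9 : C * n ≤ 2 * c n * v n ^ β := by
        calc C * n ≤ (F (v n) * v n ^ β) * n := by gcongr; exact hCx _ h5
          _ = (n * F (v n)) * v n ^ β := by ring
          _ ≤ _ := by gcongr
      have h10 := Real.log_le_log (by positivity) h9
      rw [Real.log_mul (by positivity) (by positivity), Real.log_mul (by positivity) (by positivity),
        Real.log_mul (by positivity) (by positivity), Real.log_rpow hvn] at h10
      rw [div_lt_iff₀ hη0] at h7 h8
      obtain ⟨h11, h12⟩ := abs_le.1 h3
      set L := Real.log n
      have hL : 0 ≤ L := by
        have : 0 ≤ η * L := (abs_nonneg _).trans h3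
        exact nonneg_of_mul_nonneg_right this hη0
      -- β log v ≥ (1 - 2η) L
      have h13 : (1 - 2 * η) * L ≤ β * Real.log (v n) := by linarith
      have h14 : β * ((1 + 3 * η) * L) ≤ (1 - 2 * η) * L := by
        have e1 : β * η ≤ 1 * η := mul_le_mul_of_nonneg_right hβ1.le hη0.le
        have e2 : β = 1 - 5 * η := by rw [hη]; ring
        have e3 : β * (1 + 3 * η) ≤ 1 - 2 * η := by linarith
        calc β * ((1 + 3 * η) * L) = (β * (1 + 3 * η)) * L := by ring
          _ ≤ _ := mul_le_mul_of_nonneg_right e3 hL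
      have h15 : (1 + 3 * η) * L ≤ Real.log (v n) := le_of_mul_le_mul_left (h14.trans h13) hβ0
      linarith
    have hsub : (μ {ω | sampleMoment X 1 n ω < (n:ℝ) ^ η}).toReal ≤
        (μ {ω | ∑ i ∈ Finset.range n, X i ω < q * v n * c n / 2}).toReal := by
      refine measureReal_mono ?_
      intro ω hω
      rw [Set.mem_ofPred_eq] at hω ⊢
      simp only [sampleMoment, Real.rpow_one] at hω
      rw [← div_eq_inv_mul, div_lt_iff₀ hn0] at hω
      linarith
    refine hsub.trans (hch.trans (le_of_eq ?_))
    rw [abs_div, abs_of_pos (show 0 < v n ^ (2 * (1:ℝ)) * c n ^ 2 by positivity), mul_one,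
      Real.rpow_two]
    field_simp
  refine ⟨η, hη0, ?_⟩
  have hA : Tendsto (fun n => covSum μ X v 1 n / (v n ^ (2 * (1:ℝ)) * c n ^ 2)) atTop (nhds 0) := hA1
  have hlim : Tendsto (fun n => 4 * (|covSum μ X v 1 n / (v n ^ (2 * (1:ℝ)) * c n ^ 2)| / q ^ 2
      + 1 / q * (c n)⁻¹)) atTop (nhds 0) := by
    have := (((hA.abs).div_const (q ^ 2)).add
      ((tendsto_inv_atTop_zero.comp hctop).const_mul (1 / q))).const_mul 4
    simpa using this
  exact squeeze_zero' (Eventually.of_forall fun n => ENNReal.toReal_nonneg) hmain hlim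

lemma aux_frac {Ω : Type*} [MeasurableSpace Ω] (μ : Measure Ω) [IsProbabilityMeasure μ]
    (X : ℕ → Ω → ℝ) (hXmeas : ∀ i, Measurable (X i)) (n : ℕ) (hn : 0 < n) (b f δ : ℝ) (hδ : 0 < δ)
    (hf : ∀ i, (μ {ω | b < X i ω}).toReal = f) :
    (μ {ω | δ * n < ∑ i ∈ Finset.range n, (if b < X i ω then (1:ℝ) else 0)}).toReal ≤ f / δ := by
  have hn0 : (0:ℝ) < n := by exact_mod_cast hn
  have hms : ∀ i, MeasurableSet {ω | b < X i ω} := fun i =>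
    measurableSet_lt measurable_const (hXmeas i)
  have hind : ∀ i, (fun ω => if b < X i ω then (1:ℝ) else 0)
      = Set.indicator {ω | b < X i ω} (fun _ => (1:ℝ)) := by
    intro i; ext ω; simp [Set.indicator]
  have hint : ∀ i, Integrable (fun ω => if b < X i ω then (1:ℝ) else 0) μ := by
    intro i; rw [hind]; exact (integrable_const _).indicator (hms i)
  have hval : ∀ i, ∫ ω, (if b < X i ω then (1:ℝ) else 0) ∂μ = f := by
    intro i
    rw [hind, integral_indicator (hms i), ← hf i]
    simp [Measure.real]
  have hm := mul_meas_ge_le_integral_of_nonneg (μ := μ)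
    (f := fun ω => ∑ i ∈ Finset.range n, (if b < X i ω then (1:ℝ) else 0))
    (ae_of_all _ fun ω => Finset.sum_nonneg fun i _ => by split_ifs <;> simp)
    (integrable_finsetSum _ fun i _ => hint i) (δ * n)
  rw [integral_finsetSum _ fun i _ => hint i] at hm
  simp only [hval, Finset.sum_const, Finset.card_range, nsmul_eq_mul] at hm
  rw [le_div_iff₀ hδ]
  have h1 : (μ {ω | δ * n < ∑ i ∈ Finset.range n, (if b < X i ω then (1:ℝ) else 0)}).toReal ≤
    μ.real {ω | δ * n ≤ ∑ i ∈ Finset.range n, (if b < X i ω then (1:ℝ) else 0)} := by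
    refine measureReal_mono ?_
    intro ω hω
    rw [Set.mem_ofPred_eq] at hω ⊢
    exact hω.le
  have h2 : n * (μ.real {ω | δ * n ≤ ∑ i ∈ Finset.range n, (if b < X i ω then (1:ℝ) else 0)} * δ)
      ≤ n * f := by linarith
  have h3 := le_of_mul_le_mul_left h2 hn0
  exact (mul_le_mul_of_nonneg_right h1 hδ.le).trans h3

/-- key consequence : with probability tending to one, the sample mean is large and the ratio
is between `1 - ε` and `1`. -/
lemma aux_key {Ω : Type*} [MeasurableSpace Ω] (μ : Measure Ω) [IsProbabilityMeasure μ]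
    (X : ℕ → Ω → ℝ) (hXmeas : ∀ i, Measurable (X i)) (hXnn : ∀ i ω, 0 ≤ X i ω)
    (F : ℝ → ℝ) (hsurv : ∀ i, ∀ x : ℝ, 0 < x → (μ {ω | x < X i ω}).toReal = F x)
    (κ : ℝ) (hκ : 0 < κ)
    (hM : Tendsto (fun n : ℕ => (μ {ω | sampleMoment X 1 n ω < (n:ℝ) ^ κ}).toReal) atTop (nhds 0))
    (h : ℝ) (hh : 0 < h) (ε : ℝ) (hε : 0 < ε) :
    Tendsto (fun n : ℕ => (μ {ω | ¬ ((n:ℝ) ^ κ ≤ sampleMoment X 1 n ω ∧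
      1 - ε ≤ lowerMoment X h n ω / sampleMoment X 1 n ω ^ h ∧
      lowerMoment X h n ω / sampleMoment X 1 n ω ^ h ≤ 1)}).toReal) atTop (nhds 0) := by
  obtain ⟨δ, hδ0, hδ1, hδ⟩ : ∃ δ : ℝ, 0 < δ ∧ δ < 1 ∧ 1 - ε ≤ (1 - δ) * (1 - δ) ^ h := by
    have hcont : Tendsto (fun δ : ℝ => (1 - δ) * (1 - δ) ^ h) (nhdsWithin 0 (Set.Ioi 0)) (nhds 1) := by
      have h1 : Tendsto (fun δ : ℝ => 1 - δ) (nhdsWithin 0 (Set.Ioi 0)) (nhds 1) := by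
        have : Tendsto (fun δ : ℝ => 1 - δ) (nhds 0) (nhds (1 - 0)) :=
          (continuous_const.sub continuous_id).tendsto 0
        rw [sub_zero] at this
        exact this.mono_left nhdsWithin_le_nhds
      have h2 := h1.mul (h1.rpow_const (p := h) (Or.inl one_ne_zero))
      simpa using h2
    have e1 := hcont.eventually_const_lt (show 1 - ε < 1 by linarith)
    have e2 : ∀ᶠ δ : ℝ in nhdsWithin 0 (Set.Ioi 0), δ ∈ Set.Ioo (0:ℝ) 1 :=
      Ioo_mem_nhdsGT one_pos
    obtain ⟨δ, h1, h2⟩ := (e1.and e2).exists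
    exact ⟨δ, h2.1, h2.2, h1.le⟩
  have hb : Tendsto (fun n : ℕ => δ * (n:ℝ) ^ κ) atTop atTop :=
    ((tendsto_rpow_atTop hκ).comp tendsto_natCast_atTop_atTop).const_mul_atTop hδ0
  have hF0 : Tendsto F atTop (nhds 0) := by
    have h1 : Tendsto (fun x : ℝ => 1 - ProbabilityTheory.cdf (μ.map (X 0)) x) atTop (nhds 0) := by
      simpa using (ProbabilityTheory.tendsto_cdf_atTop (μ.map (X 0))).const_sub 1
    refine h1.congr' ?_
    filter_upwards [eventually_gt_atTop 0] with x hx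
    rw [← hsurv 0 x hx]
    have : IsProbabilityMeasure (μ.map (X 0)) :=
      Measure.isProbabilityMeasure_map (hXmeas 0).aemeasurable
    rw [ProbabilityTheory.cdf_eq_real, ← probReal_compl_eq_one_sub measurableSet_Iic,
      map_measureReal_apply (hXmeas 0) measurableSet_Iic.compl]
    simp only [Measure.real]
    congr 2
    ext ω; simp
  have hlim : Tendsto (fun n : ℕ => (μ {ω | sampleMoment X 1 n ω < (n:ℝ) ^ κ}).toReal
      + F (δ * (n:ℝ) ^ κ) / δ) atTop (nhds 0) := by
    simpa using hM.add ((hF0.comp hb).div_const δ)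
  refine squeeze_zero' (Eventually.of_forall fun n => ENNReal.toReal_nonneg) ?_ hlim
  filter_upwards [eventually_gt_atTop 0] with n hn
  have hn0 : (0:ℝ) < n := by exact_mod_cast hn
  have hnk : 0 < (n:ℝ) ^ κ := by positivity
  have hfr := aux_frac μ X hXmeas n hn (δ * (n:ℝ) ^ κ) (F (δ * (n:ℝ) ^ κ)) δ hδ0
    (fun i => hsurv i _ (by positivity))
  refine le_trans ?_ (add_le_add le_rfl hfr)
  refine le_trans (measureReal_mono (μ := μ) (s₂ := {ω | sampleMoment X 1 n ω < (n:ℝ) ^ κ} ∪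
    {ω | δ * n < ∑ i ∈ Finset.range n, (if δ * (n:ℝ) ^ κ < X i ω then (1:ℝ) else 0)}) ?_)
    (measureReal_union_le _ _)
  intro ω hω
  by_contra hcon
  rw [Set.mem_union, not_or, Set.mem_ofPred_eq, Set.mem_ofPred_eq, not_lt, not_lt] at hcon
  rw [Set.mem_ofPred_eq] at hω
  apply hω
  obtain ⟨h1, h2⟩ := aux_det X hXnn n hn ω h hh _ δ hnk hδ0 hδ1 hcon.1 hcon.2
  exact ⟨hcon.1, hδ.trans h1, h2⟩

/-- **Theorem (h-th central lower moments).** -/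
theorem central_lower_moments
    {Ω : Type*} [MeasurableSpace Ω] (μ : Measure Ω) [IsProbabilityMeasure μ]
    (X : ℕ → Ω → ℝ) (hXmeas : ∀ i, Measurable (X i)) (hXnn : ∀ i ω, 0 ≤ X i ω)
    (α : ℝ) (hα : 0 < α) (hα1 : α < 1)
    (l : ℝ → ℝ) (hlpos : ∀ x : ℝ, 0 < x → 0 < l x) (hl : SlowlyVarying l)
    (hsurv : ∀ i, ∀ x : ℝ, 0 < x → (μ {ω | x < X i ω}).toReal = x ^ (-α) * l x)
    (c : ℕ → ℝ) (hc : ∀ n, 0 < c n) (hctop : Tendsto c atTop atTop)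
    (hncmono : Monotone fun n : ℕ => (n : ℝ) * c n)
    (hnctop : Tendsto (fun n : ℕ => (n : ℝ) * c n) atTop atTop)
    (hclog : Tendsto (fun n : ℕ => Real.log (c n) / Real.log n) atTop (nhds 0))
    (t : ℕ → ℝ) (htpos : ∀ n, 0 < t n)
    (ht : Tendsto (fun n : ℕ => (n : ℝ) * c n * l (t n) / t n ^ α) atTop (nhds 1))
    (v : ℕ → ℝ) (hvpos : ∀ n, 0 < v n)
    (hv : Tendsto (fun n : ℕ => (n : ℝ) * l (v n) / (v n ^ α * c n)) atTop (nhds 1))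
    (hA1 : ConditionA μ X v c 1) :
    -- part (i)
    ((∀ a : ℝ, 0 < a →
      Tendsto (fun n =>
        (∑ i ∈ Finset.range n, ∑ j ∈ Finset.range n,
          if i = j then 0
          else cov μ (fun ω => if X i ω ≤ a then (1 : ℝ) else 0)
            (fun ω => if X j ω ≤ a then (1 : ℝ) else 0)) / (n : ℝ) ^ 2)
        atTop (nhds 0) →
      ∀ h : ℝ, 0 < h →
        IsOp μ (fun n ω =>
            Real.log (lowerMoment X h n ω) / Real.log (sampleMoment X 1 n ω) - h)
          (fun n => 1 / Real.log n)) ∧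
    -- part (ii)
    (∀ δ' : ℝ, 2 * (1 / α - 1) < δ' →
      Tendsto (fun n =>
        (∑ i ∈ Finset.range n, ∑ j ∈ Finset.range n,
          if i = j then 0
          else cov μ
            (fun ω => if X i ω ≤ (∫ ω', trunc (X 0) (t n) ω' ∂μ) / c n ^ (2 * δ')
              then (1 : ℝ) else 0)
            (fun ω => if X j ω ≤ (∫ ω', trunc (X 0) (t n) ω' ∂μ) / c n ^ (2 * δ')
              then (1 : ℝ) else 0)) / (n : ℝ) ^ 2)
        atTop (nhds 0) →
      ∀ h : ℝ, 0 < h →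
        TendstoInProbability μ
          (fun n ω => lowerMoment X h n ω / sampleMoment X 1 n ω ^ h) 1)) := by
  obtain ⟨κ, hκ, hM⟩ := aux_core μ X hXmeas hXnn α hα hα1 l hlpos hl hsurv c hc hctop hclog v hvpos
    hv hA1
  have key := aux_key μ X hXmeas hXnn (fun x => x ^ (-α) * l x) hsurv κ hκ hM
  refine ⟨?_, ?_⟩
  · intro a _ _ h hh ε hε
    refine ⟨Real.log 2 / κ, by have := Real.log_pos one_lt_two; positivity, ?_⟩
    filter_upwards [(key h hh (1/2) (by norm_num)).eventually_lt_const hε, eventually_gt_atTop 1]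
      with n hn hn1
    refine lt_of_le_of_lt (measureReal_mono (μ := μ) ?_) hn
    intro ω hω
    rw [Set.mem_ofPred_eq] at hω ⊢
    rintro ⟨h1, h2, h3⟩
    apply absurd hω
    rw [not_lt]
    have hn1' : (1:ℝ) < n := by exact_mod_cast hn1
    have hlogn : 0 < Real.log n := Real.log_pos hn1'
    set M := sampleMoment X 1 n ω
    set m := lowerMoment X h n ω
    have hMp : 0 < M := lt_of_lt_of_le (by positivity) h1
    have hlM : κ * Real.log n ≤ Real.log M := by
      rw [← Real.log_rpow (by positivity)]
      exact Real.log_le_log (by positivity) h1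
    have hlMp : 0 < Real.log M := lt_of_lt_of_le (by positivity) hlM
    have hMh : 0 < M ^ h := by positivity
    have hr : 0 < m / M ^ h := lt_of_lt_of_le (by norm_num) h2
    have hm : 0 < m := by
      rcases div_pos_iff.1 hr with h | h
      · exact h.1
      · exact absurd h.2 (not_lt.2 hMh.le)
    have heq : Real.log m / Real.log M - h = Real.log (m / M ^ h) / Real.log M := by
      rw [Real.log_div hm.ne' hMh.ne', Real.log_rpow hMp]
      field_simp
    have habs : |Real.log (m / M ^ h)| ≤ Real.log 2 := by
      rw [abs_of_nonpos (Real.log_nonpos hr.le h3)]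
      have := Real.log_le_log (by norm_num) h2
      rw [show (1 - 1/2 : ℝ) = 2⁻¹ by norm_num, Real.log_inv] at this
      linarith
    rw [heq, abs_div, abs_of_pos hlMp]
    calc |Real.log (m / M ^ h)| / Real.log M ≤ Real.log 2 / (κ * Real.log n) := by
          have := Real.log_pos one_lt_two
          gcongr
      _ = _ := by field_simp
  · intro δ' _ _ h hh ε hε
    refine squeeze_zero (fun n => ENNReal.toReal_nonneg) (fun n => ?_) (key h hh ε hε)
    refine measureReal_mono (μ := μ) ?_
    intro ω hω
    rw [Set.mem_ofPred_eq] at hω ⊢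
    rintro ⟨h1, h2, h3⟩
    apply absurd hω
    rw [not_lt, abs_le]
    constructor <;> linarith
end
end

section
/- On a probability space, let X₁, X₂, … be nonnegative random variables with common survival function P(Xᵢ > x) = x^{-α} l(x) for all x > 0, where α ∈ (0,1) and l is slowly varying at infinity. (a) Suppose Condition A(1) and Condition A(h) hold for some h with α < h < 1, and suppose that for some δ' > 2(1/α − 1), setting b_n := d_{n,1}/c_n^{2δ'}, one has ∑_{1≤i,j≤n, i≠j} Cov(1(Xᵢ ≤ b_n), 1(Xⱼ ≤ b_n)) = o(n²). Then M⁺_{n,h}/M_{n,1}^h →p 0 as n → ∞. (b) Suppose Condition A(h) holds for some h > 1. Then log M⁺_{n,h}/log M_{n,1} − (h−α)/(1−α) = O_p((log c_n + |log l(t_n)|)/log n) as n → ∞. -/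
open MeasureTheory Filter

noncomputable section

/-- `h`-th sample central upper moment `M⁺_{n,h}`. -/
def upperMoment {Ω : Type*} (X : ℕ → Ω → ℝ) (h : ℝ) (n : ℕ) (ω : Ω) : ℝ :=
  (n : ℝ)⁻¹ * ∑ i ∈ Finset.range n, max (X i ω - sampleMoment X 1 n ω) 0 ^ h

set_option linter.unusedSectionVars false
set_option linter.unusedVariables false
lemma aux_ratio_s16 {α : ℝ} {l : ℝ → ℝ} (hlpos : ∀ x : ℝ, 0 < x → 0 < l x)
    (hl : SlowlyVarying l) {G : ℝ → ℝ} (hG : ∀ x, 0 < x → G x = x ^ (-α) * l x)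
    {β γ : ℝ} (hβ : α < β) (hγ : γ < α) :
    ∃ x0 : ℝ, 0 < x0 ∧ ∀ x, x0 ≤ x →
      (2:ℝ) ^ (-β) * G x ≤ G (2 * x) ∧ G (2 * x) ≤ (2:ℝ) ^ (-γ) * G x := by
  have h1 : Tendsto (fun x => (2:ℝ) ^ (-α) * (l (2 * x) / l x)) atTop (nhds ((2:ℝ) ^ (-α))) := by
    simpa using (hl 2 (by norm_num)).const_mul ((2:ℝ) ^ (-α))
  have hb : (2:ℝ) ^ (-β) < (2:ℝ) ^ (-α) :=
    Real.rpow_lt_rpow_of_exponent_lt (by norm_num) (by linarith)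
  have hg : (2:ℝ) ^ (-α) < (2:ℝ) ^ (-γ) :=
    Real.rpow_lt_rpow_of_exponent_lt (by norm_num) (by linarith)
  have h2 := (h1.eventually_const_lt hb).and (h1.eventually_lt_const hg)
  obtain ⟨x0, hx0⟩ := eventually_atTop.1 h2
  refine ⟨max x0 1, by positivity, fun x hx => ?_⟩
  have hxp : 0 < x := lt_of_lt_of_le (by positivity) hx
  obtain ⟨ha, hb'⟩ := hx0 x (le_trans (le_max_left _ _) hx)
  have hGx : 0 < G x := by
    rw [hG x hxp]; exact mul_pos (Real.rpow_pos_of_pos hxp _) (hlpos x hxp)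
  have e : G (2 * x) = (2:ℝ) ^ (-α) * (l (2 * x) / l x) * G x := by
    rw [hG x hxp, hG (2 * x) (by positivity), Real.mul_rpow (by norm_num) hxp.le]
    have := (hlpos x hxp).ne'
    field_simp
  rw [e]
  exact ⟨by gcongr, by gcongr⟩

lemma aux_pow {G : ℝ → ℝ} {x0 a b : ℝ} (hx0 : 0 < x0) (ha : 0 ≤ a) (hb : 0 ≤ b)
    (H : ∀ x, x0 ≤ x → a * G x ≤ G (2 * x) ∧ G (2 * x) ≤ b * G x) (k : ℕ) :
    ∀ x, x0 ≤ x → a ^ k * G x ≤ G (2 ^ k * x) ∧ G (2 ^ k * x) ≤ b ^ k * G x := by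
  induction k with
  | zero => intro x hx; simp
  | succ k ih =>
    intro x hx
    obtain ⟨i1, i2⟩ := ih x hx
    have hx' : x0 ≤ 2 ^ k * x := by
      have : (1:ℝ) ≤ 2 ^ k := one_le_pow₀ (by norm_num)
      nlinarith
    obtain ⟨j1, j2⟩ := H _ hx'
    have e : (2:ℝ) ^ (k+1) * x = 2 * (2 ^ k * x) := by ring
    rw [e]
    constructor
    · calc a ^ (k+1) * G x = a * (a ^ k * G x) := by ring
        _ ≤ a * G (2 ^ k * x) := by gcongr
        _ ≤ _ := j1
    · calc _ ≤ b * G (2 ^ k * x) := j2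
        _ ≤ b * (b ^ k * G x) := by gcongr
        _ = _ := by ring

lemma aux_potter {G : ℝ → ℝ} {x0 β γ : ℝ} (hx0 : 0 < x0) (hβ : 0 < β) (hγ : 0 < γ)
    (hGpos : ∀ x, 0 < x → 0 < G x) (hGanti : ∀ x y, 0 < x → x ≤ y → G y ≤ G x)
    (H : ∀ x, x0 ≤ x → (2:ℝ) ^ (-β) * G x ≤ G (2 * x) ∧ G (2 * x) ≤ (2:ℝ) ^ (-γ) * G x)
    {v t : ℝ} (hv : x0 ≤ v) (hvt : v ≤ t) :
    (2:ℝ) ^ (-β) * (t / v) ^ (-β) * G v ≤ G t ∧ G t ≤ (2:ℝ) ^ γ * (t / v) ^ (-γ) * G v := by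
  have hvp : 0 < v := lt_of_lt_of_le hx0 hv
  have htp : 0 < t := lt_of_lt_of_le hvp hvt
  obtain ⟨k, hk1, hk2⟩ := exists_nat_pow_near ((one_le_div hvp).2 hvt) (by norm_num : (1:ℝ) < 2)
  have hP := aux_pow hx0 (by positivity) (by positivity) H
  have hGv := hGpos v hvp
  have e : ∀ (s : ℝ) (m : ℕ), ((2:ℝ) ^ s) ^ m = ((2:ℝ) ^ m) ^ s := fun s m => by
    rw [← Real.rpow_natCast, ← Real.rpow_natCast, ← Real.rpow_mul (by norm_num), ← Real.rpow_mul (by norm_num), mul_comm]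
  constructor
  · have h1 := (hP (k+1) v hv).1
    have h2 : G (2 ^ (k+1) * v) ≤ G t := hGanti _ _ htp (by
      rw [div_lt_iff₀ hvp] at hk2; exact hk2.le)
    refine le_trans ?_ (le_trans h1 h2)
    gcongr
    rw [pow_succ', e]
    gcongr ?_ * ?_
    exact Real.rpow_le_rpow_of_nonpos (by positivity) hk1 (by linarith)
  · have h1 := (hP k v hv).2
    have h2 : G t ≤ G (2 ^ k * v) := hGanti _ _ (by positivity) (by
      rw [le_div_iff₀ hvp] at hk1; exact hk1)
    refine le_trans h2 (le_trans h1 ?_)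
    gcongr
    have : (2:ℝ) ^ γ * (t / v) ^ (-γ) = ((t / v) / 2) ^ (-γ) := by
      rw [Real.div_rpow (x := t / v) (y := 2) (by positivity) (by norm_num), Real.rpow_neg (x := 2) (by norm_num) γ, div_inv_eq_mul, mul_comm]
    rw [this, e]
    refine Real.rpow_le_rpow_of_nonpos (by positivity) ?_ (by linarith)
    rw [pow_succ] at hk2
    linarith

section
variable {Ω : Type*} [MeasurableSpace Ω] {μ : Measure Ω} [IsProbabilityMeasure μ]

lemma trunc_meas {Y : Ω → ℝ} (hY : Measurable Y) (t : ℝ) : Measurable (trunc Y t) :=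
  Measurable.ite (measurableSet_lt hY measurable_const) hY measurable_const

lemma trunc_nonneg {Y : Ω → ℝ} (hY : ∀ ω, 0 ≤ Y ω) (t : ℝ) (ω : Ω) : 0 ≤ trunc Y t ω := by
  unfold trunc; split_ifs
  · exact hY ω
  · exact le_rfl

lemma trunc_le {Y : Ω → ℝ} (hY : ∀ ω, 0 ≤ Y ω) (t : ℝ) (ω : Ω) : trunc Y t ω ≤ Y ω := by
  unfold trunc; split_ifs
  · exact le_rfl
  · exact hY ω

lemma trunc_le' {Y : Ω → ℝ} {t : ℝ} (ht : 0 ≤ t) (ω : Ω) : trunc Y t ω ≤ t := by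
  unfold trunc; split_ifs with h
  · exact h.le
  · exact ht

lemma trunc_rpow_memLp {Y : Ω → ℝ} (hY : Measurable Y) (hY0 : ∀ ω, 0 ≤ Y ω) {t : ℝ} (ht : 0 ≤ t)
    {h : ℝ} (hh : 0 ≤ h) (p : ENNReal) : MemLp (fun ω => trunc Y t ω ^ h) p μ := by
  refine MemLp.of_bound ((trunc_meas hY t).pow_const h).aestronglyMeasurable (t ^ h) ?_
  refine Eventually.of_forall fun ω => ?_
  rw [Real.norm_of_nonneg (Real.rpow_nonneg (trunc_nonneg hY0 t ω) _)]
  exact Real.rpow_le_rpow (trunc_nonneg hY0 t ω) (trunc_le' ht ω) hh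

lemma trunc_rpow_int {Y : Ω → ℝ} (hY : Measurable Y) (hY0 : ∀ ω, 0 ≤ Y ω) {t : ℝ} (ht : 0 ≤ t)
    {h : ℝ} (hh : 0 ≤ h) : Integrable (fun ω => trunc Y t ω ^ h) μ :=
  (trunc_rpow_memLp hY hY0 ht hh 1).integrable le_rfl

lemma meas_ge_le {Y : Ω → ℝ} {G : ℝ → ℝ}
    (hs : ∀ x : ℝ, 0 < x → (μ {ω | x < Y ω}).toReal = G x) {t : ℝ} (ht : 0 < t) :
    (μ {ω | t ≤ Y ω}).toReal ≤ G (t / 2) := by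
  rw [← hs (t/2) (by positivity)]
  refine ENNReal.toReal_mono (measure_ne_top _ _) (measure_mono fun ω hω => ?_)
  simp only [Set.mem_ofPred_eq] at *
  linarith

lemma moment_step {Y : Ω → ℝ} (hY : Measurable Y) (hY0 : ∀ ω, 0 ≤ Y ω) {G : ℝ → ℝ}
    (hs : ∀ x : ℝ, 0 < x → (μ {ω | x < Y ω}).toReal = G x) {t : ℝ} (ht : 0 < t)
    {h : ℝ} (hh : 0 < h) :
    ∫ ω, trunc Y (2 * t) ω ^ h ∂μ ≤ ∫ ω, trunc Y t ω ^ h ∂μ + (2 * t) ^ h * G (t / 2) := by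
  have hms : MeasurableSet {ω | t ≤ Y ω} := measurableSet_le measurable_const hY
  have hi : Integrable (Set.indicator {ω | t ≤ Y ω} (fun _ => (2 * t) ^ h)) μ :=
    (integrable_const _).indicator hms
  calc ∫ ω, trunc Y (2 * t) ω ^ h ∂μ
      ≤ ∫ ω, (trunc Y t ω ^ h + Set.indicator {ω | t ≤ Y ω} (fun _ => (2 * t) ^ h) ω) ∂μ := by
        refine integral_mono (trunc_rpow_int hY hY0 (by positivity) hh.le)
          ((trunc_rpow_int hY hY0 ht.le hh.le).add hi) fun ω => ?_
        by_cases h1 : t ≤ Y ω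
        · have : Set.indicator {ω | t ≤ Y ω} (fun _ => (2 * t) ^ h) ω = (2 * t) ^ h :=
            Set.indicator_of_mem (show ω ∈ {ω | t ≤ Y ω} from h1) _
          simp only [this]
          have := Real.rpow_nonneg (trunc_nonneg hY0 t ω) h
          have := Real.rpow_le_rpow (trunc_nonneg hY0 (2*t) ω) (trunc_le' (by positivity) ω) hh.le
          linarith
        · have h2 : Set.indicator {ω | t ≤ Y ω} (fun _ => (2 * t) ^ h) ω = 0 :=
            Set.indicator_of_notMem (show ω ∉ {ω | t ≤ Y ω} from h1) _
          simp only [h2]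
          push Not at h1
          have h3 : Y ω < 2 * t := by linarith
          simp [trunc, h1, h3]
    _ = ∫ ω, trunc Y t ω ^ h ∂μ + (2 * t) ^ h * (μ {ω | t ≤ Y ω}).toReal := by
        rw [integral_add (trunc_rpow_int hY hY0 ht.le hh.le) hi, integral_indicator_const _ hms]
        simp [Measure.real, mul_comm]
    _ ≤ _ := by
        have := meas_ge_le hs ht
        gcongr

lemma moment_upper {α : ℝ} (hα : 0 < α) {l : ℝ → ℝ} (hlpos : ∀ x : ℝ, 0 < x → 0 < l x)
    (hl : SlowlyVarying l) {G : ℝ → ℝ} (hG : ∀ x, 0 < x → G x = x ^ (-α) * l x)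
    (hGpos : ∀ x, 0 < x → 0 < G x) (hGanti : ∀ x y, 0 < x → x ≤ y → G y ≤ G x)
    {h : ℝ} (hh : α < h) :
    ∃ K x0 : ℝ, 0 < K ∧ 0 < x0 ∧ ∀ Y : Ω → ℝ, Measurable Y → (∀ ω, 0 ≤ Y ω) →
      (∀ x : ℝ, 0 < x → (μ {ω | x < Y ω}).toReal = G x) → ∀ t, x0 ≤ t →
      ∫ ω, trunc Y t ω ^ h ∂μ ≤ K * (t ^ h * G t) := by
  have hhp : 0 < h := hα.trans hh
  obtain ⟨β, hβ1, hβ2⟩ := exists_between hh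
  obtain ⟨x1, hx1, H⟩ := aux_ratio_s16 hlpos hl hG hβ1 (show α/2 < α by linarith)
  obtain ⟨x0, hx0def⟩ : ∃ x0, x0 = 2 * x1 := ⟨_, rfl⟩
  have hx0 : 0 < x0 := by linarith
  set q : ℝ := (2:ℝ) ^ (-(h - β)) with hq
  have hq0 : 0 < q := by positivity
  have hq1 : q < 1 := Real.rpow_lt_one_of_one_lt_of_neg (by norm_num) (by linarith)
  set C : ℝ := (2:ℝ) ^ h * (2:ℝ) ^ β with hC
  have hC0 : 0 < C := by positivity
  set B : ℝ := (2 * x0) ^ h / (x0 ^ h * G (2 * x0)) with hB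
  have hG2 := hGpos (2 * x0) (by positivity)
  have hB0 : 0 < B := by positivity
  set K := max B (C * q / (1 - q)) with hK
  have hK0 : 0 < K := lt_of_lt_of_le hB0 (le_max_left _ _)
  have hKq : (K + C) * q ≤ K := by
    have : C * q / (1 - q) ≤ K := le_max_right _ _
    rw [div_le_iff₀ (by linarith)] at this
    linarith
  refine ⟨K, x0, hK0, hx0, fun Y hY hY0 hs => ?_⟩
  have base : ∀ t, x0 ≤ t → t ≤ 2 * x0 → ∫ ω, trunc Y t ω ^ h ∂μ ≤ K * (t ^ h * G t) := by
    intro t ht1 ht2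
    have htp : 0 < t := by linarith
    calc ∫ ω, trunc Y t ω ^ h ∂μ ≤ ∫ ω, (2 * x0) ^ h ∂μ := by
          refine integral_mono (trunc_rpow_int hY hY0 htp.le hhp.le) (integrable_const _) fun ω => ?_
          exact Real.rpow_le_rpow (trunc_nonneg hY0 t ω) ((trunc_le' htp.le ω).trans ht2) hhp.le
      _ = (2 * x0) ^ h := by simp
      _ = B * (x0 ^ h * G (2 * x0)) := by rw [hB]; field_simp
      _ ≤ K * (t ^ h * G t) := by
          have := hGanti t (2 * x0) htp ht2
          have := le_max_left B (C * q / (1 - q))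
          gcongr
  have ind : ∀ k : ℕ, ∀ t, x0 ≤ t → t ≤ 2 ^ (k+1) * x0 →
      ∫ ω, trunc Y t ω ^ h ∂μ ≤ K * (t ^ h * G t) := by
    intro k
    induction k with
    | zero => intro t h1 h2; exact base t h1 (by simpa using h2)
    | succ k ih =>
      intro t h1 h2
      by_cases h3 : t ≤ 2 * x0
      · exact base t h1 h3
      push Not at h3
      obtain ⟨s, rfl⟩ : ∃ s, t = 2 * s := ⟨t / 2, by ring⟩
      have hs1 : x0 ≤ s := by linarith
      have hsp : 0 < s := by linarith
      have i1 := ih s hs1 (by rw [pow_succ'] at h2; linarith)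
      have i2 := moment_step hY hY0 hs hsp hhp
      have r1 := (H (s/2) (by linarith)).1
      have r2 := (H s (by linarith)).1
      rw [show 2 * (s/2) = s by ring] at r1
      have r1' : G (s/2) ≤ (2:ℝ)^β * G s := by
        rw [Real.rpow_neg (by norm_num), inv_mul_le_iff₀ (by positivity)] at r1
        exact r1
      have e1 : (2 * s) ^ h = 2 ^ h * s ^ h := Real.mul_rpow (by norm_num) hsp.le
      have hsh : 0 < s ^ h := by positivity
      have hGs := hGpos s hsp
      calc _ ≤ _ := i2
        _ ≤ K * (s ^ h * G s) + (2 * s) ^ h * ((2:ℝ)^β * G s) := by gcongr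
        _ = (K + C) * (s ^ h * G s) := by rw [e1, hC]; ring
        _ = (K + C) * q * (2 ^ h * s ^ h * ((2:ℝ) ^ (-β) * G s)) := by
            have : q * (2 ^ h * (2:ℝ) ^ (-β)) = 1 := by
              rw [hq, ← Real.rpow_add (by norm_num), ← Real.rpow_add (by norm_num)]
              rw [show -(h - β) + (h + -β) = 0 by ring, Real.rpow_zero]
            linear_combination (-(K + C) * s ^ h * G s) * this
        _ ≤ K * ((2 * s) ^ h * G (2 * s)) := by rw [e1]; gcongr
  intro t ht
  obtain ⟨k, -, hk2⟩ := exists_nat_pow_near ((one_le_div hx0).2 ht) (by norm_num : (1:ℝ) < 2)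
  exact ind k t ht ((div_lt_iff₀ hx0).1 hk2).le

lemma moment_lower {α : ℝ} (hα : 0 < α) {l : ℝ → ℝ} (hlpos : ∀ x : ℝ, 0 < x → 0 < l x)
    (hl : SlowlyVarying l) {G : ℝ → ℝ} (hG : ∀ x, 0 < x → G x = x ^ (-α) * l x)
    (hGpos : ∀ x, 0 < x → 0 < G x) (hGanti : ∀ x y, 0 < x → x ≤ y → G y ≤ G x)
    {h : ℝ} (hh : 0 < h) :
    ∃ κ x0 : ℝ, 0 < κ ∧ 0 < x0 ∧ ∀ Y : Ω → ℝ, Measurable Y → (∀ ω, 0 ≤ Y ω) →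
      (∀ x : ℝ, 0 < x → (μ {ω | x < Y ω}).toReal = G x) → ∀ t, x0 ≤ t →
      κ * (t ^ h * G t) ≤ ∫ ω, trunc Y t ω ^ h ∂μ := by
  obtain ⟨x1, hx1, H⟩ := aux_ratio_s16 hlpos hl hG (show α < α + 1 by linarith) (show α/2 < α by linarith)
  set g : ℝ := (2:ℝ) ^ (α/2) with hg
  have hg1 : 1 < g := Real.one_lt_rpow (by norm_num) (by linarith)
  refine ⟨(1/4 : ℝ) ^ h * (g - 1), 4 * x1, mul_pos (by positivity) (by linarith), by linarith, ?_⟩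
  intro Y hY hY0 hs t ht
  have htp : 0 < t := by linarith
  have hms1 : MeasurableSet {ω | t / 4 < Y ω} := measurableSet_lt measurable_const hY
  have hms2 : MeasurableSet {ω | t ≤ Y ω} := measurableSet_le measurable_const hY
  have hms : MeasurableSet ({ω | t / 4 < Y ω} \ {ω | t ≤ Y ω}) := hms1.diff hms2
  have hmeas : (g - 1) * G t ≤ μ.real ({ω | t / 4 < Y ω} \ {ω | t ≤ Y ω}) := by
    rw [measureReal_sdiff (by intro ω hω; simp only [Set.mem_ofPred_eq] at *; linarith) hms2]
    have a1 : μ.real {ω | t / 4 < Y ω} = G (t/4) := hs (t/4) (by positivity)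
    have a2 : μ.real {ω | t ≤ Y ω} ≤ G (t/2) := meas_ge_le hs htp
    have a3 := (H (t/4) (by linarith)).2
    rw [show 2 * (t/4) = t/2 by ring, Real.rpow_neg (by norm_num), ← hg, 
      ← div_eq_inv_mul, le_div_iff₀ (by linarith)] at a3
    have a4 := hGanti (t/2) t (by linarith) (by linarith)
    nlinarith
  calc (1/4 : ℝ) ^ h * (g - 1) * (t ^ h * G t) = (t/4) ^ h * ((g-1) * G t) := by
        rw [show t/4 = 1/4 * t by ring, Real.mul_rpow (by norm_num) htp.le]; ring
    _ ≤ (t/4)^h * μ.real ({ω | t / 4 < Y ω} \ {ω | t ≤ Y ω}) := by gcongr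
    _ = ∫ ω, Set.indicator ({ω | t / 4 < Y ω} \ {ω | t ≤ Y ω}) (fun _ => (t/4)^h) ω ∂μ := by
        rw [integral_indicator_const _ hms]; simp [mul_comm]
    _ ≤ _ := by
        refine integral_mono ((integrable_const _).indicator hms)
          (trunc_rpow_int hY hY0 htp.le hh.le) fun ω => ?_
        by_cases h1 : ω ∈ ({ω | t / 4 < Y ω} \ {ω | t ≤ Y ω})
        · rw [Set.indicator_of_mem h1]
          simp only [Set.mem_sdiff, Set.mem_ofPred_eq, not_le] at h1
          simp only [trunc, h1.2, if_true]
          exact Real.rpow_le_rpow (by positivity) h1.1.le hh.le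
        · rw [Set.indicator_of_notMem h1]
          exact Real.rpow_nonneg (trunc_nonneg hY0 t ω) _

end
lemma seq_top {G : ℝ → ℝ} (hGpos : ∀ x, 0 < x → 0 < G x)
    (hGanti : ∀ x y, 0 < x → x ≤ y → G y ≤ G x) {u : ℕ → ℝ} (hu : ∀ n, 0 < u n)
    (h0 : Tendsto (fun n => G (u n)) atTop (nhds 0)) : Tendsto u atTop atTop := by
  rw [tendsto_atTop]
  intro b
  filter_upwards [h0.eventually_lt_const (hGpos (max b 1) (by positivity))] with n hn
  by_contra hb
  push Not at hb
  have := hGanti (u n) (max b 1) (hu n) (hb.le.trans (le_max_left _ _))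
  linarith

lemma logn_top : Tendsto (fun n : ℕ => Real.log n) atTop atTop :=
  Real.tendsto_log_atTop.comp tendsto_natCast_atTop_atTop

lemma logc_le {c : ℕ → ℝ} (hclog : Tendsto (fun n : ℕ => Real.log (c n) / Real.log n) atTop (nhds 0))
    {η : ℝ} (hη : 0 < η) : ∀ᶠ n : ℕ in atTop, Real.log (c n) ≤ η * Real.log n := by
  filter_upwards [hclog.eventually_lt_const hη, logn_top.eventually_gt_atTop 0] with n h1 h2
  rw [div_lt_iff₀ h2] at h1
  exact h1.le

lemma cn_zero {c : ℕ → ℝ} (hc : ∀ n, 0 < c n)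
    (hclog : Tendsto (fun n : ℕ => Real.log (c n) / Real.log n) atTop (nhds 0)) :
    Tendsto (fun n : ℕ => c n / n) atTop (nhds 0) := by
  have h1 : Tendsto (fun n : ℕ => Real.exp (-(1/2 * Real.log n))) atTop (nhds 0) :=
    Real.tendsto_exp_neg_atTop_nhds_zero.comp (logn_top.const_mul_atTop (by norm_num))
  refine squeeze_zero' (Eventually.of_forall fun n => div_nonneg (hc n).le (Nat.cast_nonneg n)) ?_ h1
  filter_upwards [logc_le hclog (show (0:ℝ) < 1/2 by norm_num), eventually_gt_atTop 0] with n hn hn0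
  have hn0' : (0:ℝ) < n := by exact_mod_cast hn0
  have hd : 0 < c n / n := div_pos (hc n) hn0'
  rw [← Real.log_le_iff_le_exp hd, Real.log_div (hc n).ne' hn0'.ne']
  linarith

lemma v_top {G : ℝ → ℝ} (hGpos : ∀ x, 0 < x → 0 < G x)
    (hGanti : ∀ x y, 0 < x → x ≤ y → G y ≤ G x) {c v : ℕ → ℝ} (hc : ∀ n, 0 < c n)
    (hclog : Tendsto (fun n : ℕ => Real.log (c n) / Real.log n) atTop (nhds 0))
    (hvpos : ∀ n, 0 < v n)
    (hv : Tendsto (fun n : ℕ => (n : ℝ) * G (v n) / c n) atTop (nhds 1)) :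
    Tendsto v atTop atTop := by
  refine seq_top hGpos hGanti hvpos ?_
  have := hv.mul (cn_zero hc hclog)
  rw [mul_zero] at this
  refine this.congr' ?_
  filter_upwards [eventually_gt_atTop 0] with n hn0
  have hn0' : (n:ℝ) ≠ 0 := by exact_mod_cast hn0.ne'
  have := (hc n).ne'
  field_simp

lemma t_top {G : ℝ → ℝ} (hGpos : ∀ x, 0 < x → 0 < G x)
    (hGanti : ∀ x y, 0 < x → x ≤ y → G y ≤ G x) {c t : ℕ → ℝ} (hc : ∀ n, 0 < c n)
    (hnctop : Tendsto (fun n : ℕ => (n : ℝ) * c n) atTop atTop)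
    (htpos : ∀ n, 0 < t n)
    (ht : Tendsto (fun n : ℕ => (n : ℝ) * c n * G (t n)) atTop (nhds 1)) :
    Tendsto t atTop atTop := by
  refine seq_top hGpos hGanti htpos ?_
  have := ht.mul (tendsto_inv_atTop_zero.comp hnctop)
  rw [mul_zero] at this
  refine this.congr' ?_
  filter_upwards [eventually_gt_atTop 0] with n hn0
  have hn0' : (n:ℝ) ≠ 0 := by exact_mod_cast hn0.ne'
  have := (hc n).ne'
  simp only [Function.comp]
  field_simp

lemma v_log {α : ℝ} (hα : 0 < α) (hα1 : α < 1) {l : ℝ → ℝ} (hlpos : ∀ x : ℝ, 0 < x → 0 < l x)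
    (hl : SlowlyVarying l) {G : ℝ → ℝ} (hG : ∀ x, 0 < x → G x = x ^ (-α) * l x)
    (hGpos : ∀ x, 0 < x → 0 < G x)
    (hGanti : ∀ x y, 0 < x → x ≤ y → G y ≤ G x) {c v : ℕ → ℝ} (hc : ∀ n, 0 < c n)
    (hclog : Tendsto (fun n : ℕ => Real.log (c n) / Real.log n) atTop (nhds 0))
    (hvpos : ∀ n, 0 < v n)
    (hv : Tendsto (fun n : ℕ => (n : ℝ) * G (v n) / c n) atTop (nhds 1)) :
    ∃ ρ : ℝ, 0 < ρ ∧ ∀ᶠ n : ℕ in atTop, (1 + ρ) * Real.log n ≤ Real.log (v n) := by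
  obtain ⟨β, hβ1, hβ2⟩ := exists_between hα1
  have hβ : 0 < β := hα.trans hβ1
  obtain ⟨x0, hx0, H⟩ := aux_ratio_s16 hlpos hl hG hβ1 (show α/2 < α by linarith)
  refine ⟨(1 - β) / (2 * β), div_pos (by linarith) (by linarith), ?_⟩
  set D : ℝ := Real.log 2 - (-β * Real.log 2 + β * Real.log x0 + Real.log (G x0))
  have hη : 0 < (1 - β) / 4 := by linarith
  filter_upwards [logc_le hclog hη, eventually_gt_atTop 0,
    (v_top hGpos hGanti hc hclog hvpos hv).eventually_ge_atTop x0,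
    hv.eventually_lt_const (show (1:ℝ) < 2 by norm_num),
    (logn_top.const_mul_atTop hη).eventually_ge_atTop D] with n h1 hn0 h2 h3 h4
  have hn0' : (0:ℝ) < n := by exact_mod_cast hn0
  have hP := (aux_potter hx0 hβ (show 0 < α/2 by linarith) hGpos hGanti H le_rfl h2).1
  have hGx := hGpos x0 hx0
  have hvn := hvpos n
  have hcn := hc n
  rw [div_lt_iff₀ hcn] at h3
  have h5 : (n:ℝ) * ((2:ℝ) ^ (-β) * (v n / x0) ^ (-β) * G x0) ≤ 2 * c n :=
    (mul_le_mul_of_nonneg_left hP hn0'.le).trans h3.le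
  have h6 := Real.log_le_log (by positivity) h5
  rw [Real.log_mul (by positivity) (by positivity), Real.log_mul (by positivity) (by positivity),
    Real.log_mul (by positivity) (by positivity), Real.log_rpow (by norm_num),
    Real.log_rpow (by positivity), Real.log_div hvn.ne' hx0.ne', Real.log_mul (by norm_num) hcn.ne'] at h6
  have h7 : (1 + β) / 2 * Real.log n ≤ β * Real.log (v n) := by
    simp only [D] at h4
    nlinarith
  have h8 : (1 + (1 - β) / (2 * β)) = ((1 + β) / 2) / β := by field_simp; ring
  rw [h8, div_mul_eq_mul_div, div_le_iff₀ hβ]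
  linarith

lemma tv_log {α : ℝ} (hα : 0 < α) {l : ℝ → ℝ} (hlpos : ∀ x : ℝ, 0 < x → 0 < l x)
    (hl : SlowlyVarying l) {G : ℝ → ℝ} (hG : ∀ x, 0 < x → G x = x ^ (-α) * l x)
    (hGpos : ∀ x, 0 < x → 0 < G x)
    (hGanti : ∀ x y, 0 < x → x ≤ y → G y ≤ G x) {c v t : ℕ → ℝ} (hc : ∀ n, 0 < c n)
    (hctop : Tendsto c atTop atTop)
    (hclog : Tendsto (fun n : ℕ => Real.log (c n) / Real.log n) atTop (nhds 0))
    (hvpos : ∀ n, 0 < v n)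
    (hv : Tendsto (fun n : ℕ => (n : ℝ) * G (v n) / c n) atTop (nhds 1))
    (htpos : ∀ n, 0 < t n)
    (ht : Tendsto (fun n : ℕ => (n : ℝ) * c n * G (t n)) atTop (nhds 1)) :
    ∃ C : ℝ, 0 < C ∧ ∀ᶠ n : ℕ in atTop, Real.log (v n) ≤ Real.log (t n) ∧
      Real.log (t n) ≤ Real.log (v n) + C * Real.log (c n) := by
  obtain ⟨x0, hx0, H⟩ := aux_ratio_s16 hlpos hl hG (show α < α + 1 by linarith) (show α/2 < α by linarith)
  refine ⟨3 / (α/2), by positivity, ?_⟩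
  filter_upwards [eventually_gt_atTop 0,
    (v_top hGpos hGanti hc hclog hvpos hv).eventually_ge_atTop x0,
    hv.eventually_lt_const (show (1:ℝ) < 2 by norm_num),
    hv.eventually_const_lt (show (1/2:ℝ) < 1 by norm_num),
    ht.eventually_lt_const (show (1:ℝ) < 2 by norm_num),
    ht.eventually_const_lt (show (1/2:ℝ) < 1 by norm_num),
    hctop.eventually_gt_atTop 2,
    (Real.tendsto_log_atTop.comp hctop).eventually_ge_atTop ((2 + α/2) * Real.log 2)]
    with n hn0 h2 h3 h4 h5 h6 h7 h8
  have hn0' : (0:ℝ) < n := by exact_mod_cast hn0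
  have hvn := hvpos n
  have hcn := hc n
  have htn := htpos n
  rw [div_lt_iff₀ hcn] at h3
  rw [lt_div_iff₀ hcn] at h4
  have hvt : v n ≤ t n := by
    by_contra hlt
    push Not at hlt
    have := hGanti _ _ htn hlt.le
    have : (n:ℝ) * G (v n) ≤ n * G (t n) := by gcongr
    nlinarith
  refine ⟨Real.log_le_log hvn hvt, ?_⟩
  have hP := (aux_potter hx0 (show 0 < α + 1 by linarith) (show 0 < α/2 by linarith) hGpos hGanti H h2 hvt).2
  have hGv := hGpos _ hvn
  have h9 : 1/2 ≤ c n * ((2:ℝ) ^ (α/2) * (t n / v n) ^ (-(α/2)) * (2 * c n)) := by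
    calc 1/2 ≤ n * c n * G (t n) := h6.le
      _ ≤ n * c n * ((2:ℝ) ^ (α/2) * (t n / v n) ^ (-(α/2)) * G (v n)) := by gcongr
      _ = c n * ((2:ℝ) ^ (α/2) * (t n / v n) ^ (-(α/2)) * (n * G (v n))) := by ring
      _ ≤ _ := by gcongr
  have h10 := Real.log_le_log (by norm_num) h9
  rw [Real.log_mul (by positivity) (by positivity), Real.log_mul (by positivity) (by positivity),
    Real.log_mul (by positivity) (by positivity), Real.log_rpow (by norm_num),
    Real.log_rpow (by positivity), Real.log_div htn.ne' hvn.ne', Real.log_mul (by norm_num) hcn.ne',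
    one_div, Real.log_inv] at h10
  simp only [Function.comp] at h8
  have h11 : (α/2) * (Real.log (t n) - Real.log (v n)) ≤ 3 * Real.log (c n) := by nlinarith
  rw [← sub_le_iff_le_add', div_mul_eq_mul_div, le_div_iff₀ (by positivity)]
  linarith

section
variable {Ω : Type*} [MeasurableSpace Ω] {μ : Measure Ω} [IsProbabilityMeasure μ]

lemma var_bound {X : ℕ → Ω → ℝ} (hXmeas : ∀ i, Measurable (X i)) (hXnn : ∀ i ω, 0 ≤ X i ω)
    {v : ℕ → ℝ} (hvpos : ∀ n, 0 < v n) {h : ℝ} (hh : 0 < h) (n : ℕ) :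
    ProbabilityTheory.variance (fun ω => ∑ i ∈ Finset.range n, trunc (X i) (v n) ω ^ h) μ ≤
      (∑ i ∈ Finset.range n, ∫ ω, trunc (X i) (v n) ω ^ (2 * h) ∂μ) + covSum μ X v h n := by
  have hm : ∀ i, MemLp (fun ω => trunc (X i) (v n) ω ^ h) 2 μ := fun i =>
    trunc_rpow_memLp (hXmeas i) (hXnn i) (hvpos n).le hh.le 2
  rw [ProbabilityTheory.variance_fun_sum' (fun i _ => hm i), covSum, ← Finset.sum_add_distrib]
  refine Finset.sum_le_sum fun i hi => ?_
  have e : ∀ j, ProbabilityTheory.covariance (fun ω => trunc (X i) (v n) ω ^ h) (fun ω => trunc (X j) (v n) ω ^ h) μ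
      = cov μ (fun ω => trunc (X i) (v n) ω ^ h) (fun ω => trunc (X j) (v n) ω ^ h) := fun j => by
    rw [ProbabilityTheory.covariance_eq_sub (hm i) (hm j)]; rfl
  have hd : ProbabilityTheory.covariance (fun ω => trunc (X i) (v n) ω ^ h) (fun ω => trunc (X i) (v n) ω ^ h) μ
      ≤ ∫ ω, trunc (X i) (v n) ω ^ (2 * h) ∂μ := by
    rw [ProbabilityTheory.covariance_self (hm i).aestronglyMeasurable.aemeasurable]
    refine (ProbabilityTheory.variance_le_expectation_sq (hm i).aestronglyMeasurable).trans (le_of_eq ?_)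
    refine integral_congr_ae (Eventually.of_forall fun ω => ?_)
    simp only [Pi.pow_apply]
    rw [mul_comm, Real.rpow_mul (trunc_nonneg (hXnn i) _ ω), Real.rpow_two]
  rw [← Finset.add_sum_erase _ _ hi, ← Finset.add_sum_erase _ (fun j => if i = j then (0:ℝ) else _) hi]
  simp only [if_true, zero_add]
  refine add_le_add hd (le_of_eq ?_)
  refine Finset.sum_congr rfl fun j hj => ?_
  rw [if_neg (Finset.ne_of_mem_erase hj).symm, e]

lemma cheb {X : ℕ → Ω → ℝ} (hXmeas : ∀ i, Measurable (X i)) (hXnn : ∀ i ω, 0 ≤ X i ω)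
    {α : ℝ} (hα : 0 < α) {l : ℝ → ℝ} (hlpos : ∀ x : ℝ, 0 < x → 0 < l x)
    (hl : SlowlyVarying l) {G : ℝ → ℝ} (hG : ∀ x, 0 < x → G x = x ^ (-α) * l x)
    (hGpos : ∀ x, 0 < x → 0 < G x) (hGanti : ∀ x y, 0 < x → x ≤ y → G y ≤ G x)
    (hs : ∀ i, ∀ x : ℝ, 0 < x → (μ {ω | x < X i ω}).toReal = G x)
    {c v : ℕ → ℝ} (hc : ∀ n, 0 < c n) (hctop : Tendsto c atTop atTop)
    (hvpos : ∀ n, 0 < v n) (hvtop : Tendsto v atTop atTop)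
    (hv : Tendsto (fun n : ℕ => (n : ℝ) * G (v n) / c n) atTop (nhds 1))
    {h : ℝ} (hh : α < h) (hA : ConditionA μ X v c h) :
    ∃ κ : ℝ, 0 < κ ∧ Tendsto (fun n : ℕ =>
      μ.real {ω | ∑ i ∈ Finset.range n, X i ω ^ h < κ * (v n ^ h * c n)}) atTop (nhds 0) := by
  have hhp : 0 < h := hα.trans hh
  obtain ⟨κ, x1, hκ, hx1, H1⟩ := moment_lower (μ := μ) hα hlpos hl hG hGpos hGanti hhp
  obtain ⟨K, x2, hK, hx2, H2⟩ := moment_upper (μ := μ) hα hlpos hl hG hGpos hGanti (show α < 2 * h by linarith)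
  refine ⟨κ / 4, by positivity, ?_⟩
  have hlim : Tendsto (fun n => (2 * K * (c n)⁻¹ + covSum μ X v h n / (v n ^ (2 * h) * c n ^ 2)) / (κ / 4) ^ 2)
      atTop (nhds 0) := by
    have := (((tendsto_inv_atTop_zero.comp hctop).const_mul (2 * K)).add hA).div_const ((κ / 4) ^ 2)
    simpa using this
  refine squeeze_zero' (Eventually.of_forall fun n => measureReal_nonneg) ?_ hlim
  filter_upwards [hvtop.eventually_ge_atTop x1, hvtop.eventually_ge_atTop x2,
    hv.eventually_lt_const (show (1:ℝ) < 2 by norm_num),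
    hv.eventually_const_lt (show (1/2:ℝ) < 1 by norm_num)] with n h1 h2 h3 h4
  have hvn := hvpos n
  have hcn := hc n
  rw [div_lt_iff₀ hcn] at h3
  rw [lt_div_iff₀ hcn] at h4
  have hm : ∀ i, MemLp (fun ω => trunc (X i) (v n) ω ^ h) 2 μ := fun i =>
    trunc_rpow_memLp (hXmeas i) (hXnn i) (hvpos n).le hhp.le 2
  set S : Ω → ℝ := fun ω => ∑ i ∈ Finset.range n, trunc (X i) (v n) ω ^ h with hS
  have hSm : MemLp S 2 μ := memLp_finsetSum _ fun i _ => hm i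
  have hES : κ / 2 * (v n ^ h * c n) ≤ ∫ ω, S ω ∂μ := by
    rw [hS, integral_finsetSum _ fun i _ => trunc_rpow_int (hXmeas i) (hXnn i) hvn.le hhp.le]
    calc κ / 2 * (v n ^ h * c n) = κ * (v n ^ h * (1/2 * c n)) := by ring
      _ ≤ κ * (v n ^ h * (n * G (v n))) := by gcongr
      _ = ∑ i ∈ Finset.range n, κ * (v n ^ h * G (v n)) := by simp; ring
      _ ≤ _ := Finset.sum_le_sum fun i _ => H1 (X i) (hXmeas i) (hXnn i) (hs i) _ h1
  have hVar : ProbabilityTheory.variance S μ ≤ 2 * K * (v n ^ (2 * h) * c n) + covSum μ X v h n := by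
    refine (var_bound hXmeas hXnn hvpos hhp n).trans ?_
    gcongr
    calc _ ≤ ∑ i ∈ Finset.range n, K * (v n ^ (2 * h) * G (v n)) :=
          Finset.sum_le_sum fun i _ => H2 (X i) (hXmeas i) (hXnn i) (hs i) _ h2
      _ = K * (v n ^ (2 * h) * (n * G (v n))) := by simp; ring
      _ ≤ K * (v n ^ (2 * h) * (2 * c n)) := by gcongr
      _ = _ := by ring
  have hr : 0 < κ / 4 * (v n ^ h * c n) := by positivity
  have hch := ProbabilityTheory.meas_ge_le_variance_div_sq hSm hr
  have hch2 : μ.real {ω | κ / 4 * (v n ^ h * c n) ≤ |S ω - ∫ x, S x ∂μ|} ≤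
      ProbabilityTheory.variance S μ / (κ / 4 * (v n ^ h * c n)) ^ 2 := by
    refine ENNReal.toReal_le_of_le_ofReal ?_ hch
    exact div_nonneg (ProbabilityTheory.variance_nonneg _ _) (by positivity)
  calc _ ≤ μ.real {ω | κ / 4 * (v n ^ h * c n) ≤ |S ω - ∫ x, S x ∂μ|} := by
        refine measureReal_mono fun ω hω => ?_
        simp only [Set.mem_ofPred_eq] at *
        have : S ω ≤ ∑ i ∈ Finset.range n, X i ω ^ h := Finset.sum_le_sum fun i _ =>
          Real.rpow_le_rpow (trunc_nonneg (hXnn i) _ _) (trunc_le (hXnn i) _ _) hhp.le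
        rw [abs_sub_comm]
        refine le_trans ?_ (le_abs_self _)
        linarith
    _ ≤ _ := hch2
    _ ≤ (2 * K * (v n ^ (2 * h) * c n) + covSum μ X v h n) / (κ / 4 * (v n ^ h * c n)) ^ 2 := by gcongr
    _ = _ := by
        have e : (v n ^ h) ^ 2 = v n ^ (2 * h) := by
          rw [mul_comm, Real.rpow_mul hvn.le, Real.rpow_two]
        have : 0 < v n ^ (2 * h) := by positivity
        rw [mul_pow, mul_pow, e]
        field_simp

lemma sum_upper {X : ℕ → Ω → ℝ} (hXmeas : ∀ i, Measurable (X i)) (hXnn : ∀ i ω, 0 ≤ X i ω)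
    {α : ℝ} (hα : 0 < α) (hα1 : α < 1) {l : ℝ → ℝ} (hlpos : ∀ x : ℝ, 0 < x → 0 < l x)
    (hl : SlowlyVarying l) {G : ℝ → ℝ} (hG : ∀ x, 0 < x → G x = x ^ (-α) * l x)
    (hGpos : ∀ x, 0 < x → 0 < G x) (hGanti : ∀ x y, 0 < x → x ≤ y → G y ≤ G x)
    (hs : ∀ i, ∀ x : ℝ, 0 < x → (μ {ω | x < X i ω}).toReal = G x)
    {c t : ℕ → ℝ} (hc : ∀ n, 0 < c n) (hctop : Tendsto c atTop atTop)
    (htpos : ∀ n, 0 < t n) (httop : Tendsto t atTop atTop)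
    (ht : Tendsto (fun n : ℕ => (n : ℝ) * c n * G (t n)) atTop (nhds 1)) :
    Tendsto (fun n : ℕ =>
      μ.real {ω | t n < ∑ i ∈ Finset.range n, X i ω}) atTop (nhds 0) := by
  obtain ⟨K, x2, hK, hx2, H2⟩ := moment_upper (μ := μ) hα hlpos hl hG hGpos hGanti hα1
  obtain ⟨x0, hx0, H⟩ := aux_ratio_s16 hlpos hl hG (show α < α + 1 by linarith) (show α/2 < α by linarith)
  set A : ℝ := (2:ℝ) ^ (α + 1) with hAdef
  have hlim : Tendsto (fun n => (2 * A + 2 * K) * (c n)⁻¹) atTop (nhds 0) := by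
    simpa using (tendsto_inv_atTop_zero.comp hctop).const_mul (2 * A + 2 * K)
  refine squeeze_zero' (Eventually.of_forall fun n => measureReal_nonneg) ?_ hlim
  filter_upwards [httop.eventually_ge_atTop x2, httop.eventually_ge_atTop (2 * x0),
    ht.eventually_lt_const (show (1:ℝ) < 2 by norm_num)] with n h1 h2 h3
  have htn := htpos n
  have hcn := hc n
  have h3' : n * G (t n) ≤ 2 * (c n)⁻¹ := by
    rw [← div_eq_mul_inv, le_div_iff₀ hcn]; linarith
  have r1 := (H (t n / 2) (by linarith)).1
  rw [show 2 * (t n/2) = t n by ring, Real.rpow_neg (by norm_num), inv_mul_le_iff₀ (by positivity)] at r1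
  set S : Ω → ℝ := fun ω => ∑ i ∈ Finset.range n, trunc (X i) (t n) ω ^ (1:ℝ) with hS
  have hSi : Integrable S μ :=
    integrable_finsetSum _ fun i _ => trunc_rpow_int (hXmeas i) (hXnn i) htn.le zero_le_one
  have hSnn : ∀ ω, 0 ≤ S ω := fun ω => Finset.sum_nonneg fun i _ =>
    Real.rpow_nonneg (trunc_nonneg (hXnn i) _ _) _
  have hsub : {ω | t n < ∑ i ∈ Finset.range n, X i ω} ⊆
      (⋃ i ∈ Finset.range n, {ω | t n ≤ X i ω}) ∪ {ω | t n ≤ S ω} := by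
    intro ω hω
    by_cases hb : ∃ i ∈ Finset.range n, t n ≤ X i ω
    · left
      obtain ⟨i, hi, hi2⟩ := hb
      exact Set.mem_biUnion (x := i) hi hi2
    · right
      push Not at hb
      have : S ω = ∑ i ∈ Finset.range n, X i ω := Finset.sum_congr rfl fun i hi => by
        simp [trunc, hb i hi]
      simp only [Set.mem_ofPred_eq] at *
      rw [this]; exact hω.le
  have b1 : μ.real (⋃ i ∈ Finset.range n, {ω | t n ≤ X i ω}) ≤ 2 * A * (c n)⁻¹ := by
    refine (measureReal_biUnion_finset_le _ _).trans ?_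
    calc _ ≤ ∑ i ∈ Finset.range n, A * G (t n) := Finset.sum_le_sum fun i _ =>
          (meas_ge_le (hs i) htn).trans r1
      _ = A * (n * G (t n)) := by simp; ring
      _ ≤ A * (2 * (c n)⁻¹) := by gcongr
      _ = _ := by ring
  have b2 : μ.real {ω | t n ≤ S ω} ≤ 2 * K * (c n)⁻¹ := by
    have m1 := mul_meas_ge_le_integral_of_nonneg (Eventually.of_forall hSnn) hSi (t n)
    have m2 : ∫ ω, S ω ∂μ ≤ t n * (2 * K * (c n)⁻¹) := by
      rw [hS, integral_finsetSum _ fun i _ => trunc_rpow_int (hXmeas i) (hXnn i) htn.le zero_le_one]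
      calc _ ≤ ∑ i ∈ Finset.range n, K * (t n ^ (1:ℝ) * G (t n)) :=
            Finset.sum_le_sum fun i _ => H2 (X i) (hXmeas i) (hXnn i) (hs i) _ h1
        _ = t n * (K * (n * G (t n))) := by simp; ring
        _ ≤ t n * (K * (2 * (c n)⁻¹)) := by gcongr
        _ = _ := by ring
    exact le_of_mul_le_mul_left (m1.trans m2) htn
  calc _ ≤ _ := measureReal_mono hsub
    _ ≤ _ := measureReal_union_le _ _
    _ ≤ 2 * A * (c n)⁻¹ + 2 * K * (c n)⁻¹ := add_le_add b1 b2
    _ = _ := by ring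

end
lemma young_aux {h : ℝ} (hh0 : 0 < h) (hh1 : h < 1) {η : ℝ} (hη : 0 < η) :
    ∃ C : ℝ, 0 < C ∧ ∀ y : ℝ, 0 ≤ y → y ^ h ≤ η * y + C := by
  set K : ℝ := η ^ (1 / (h - 1)) with hK
  have hK0 : 0 < K := by positivity
  refine ⟨K ^ h, by positivity, fun y hy => ?_⟩
  rcases le_total y K with h1 | h1
  · have := Real.rpow_le_rpow hy h1 hh0.le
    have : 0 ≤ η * y := by positivity
    linarith
  · have hyp : 0 < y := hK0.trans_le h1
    have e : y ^ h = y ^ (h - 1) * y := by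
      rw [Real.rpow_sub_one hyp.ne']; field_simp
    have e2 : y ^ (h - 1) ≤ η := by
      calc y ^ (h - 1) ≤ K ^ (h - 1) := Real.rpow_le_rpow_of_nonpos hK0 h1 (by linarith)
        _ = η := by
          rw [hK, ← Real.rpow_mul hη.le, one_div_mul_cancel (by linarith), Real.rpow_one]
    rw [e]
    have : y ^ (h - 1) * y ≤ η * y := by gcongr
    have : 0 < K ^ h := by positivity
    linarith

lemma ratio_bound {Ω : Type*} {X : ℕ → Ω → ℝ} (hXnn : ∀ i ω, 0 ≤ X i ω) {h : ℝ} (hh : 0 < h)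
    {η C B : ℝ} (hη : 0 < η) (hC : 0 < C) (hy : ∀ y : ℝ, 0 ≤ y → y ^ h ≤ η * y + C)
    (hB : 0 < B) {n : ℕ} {ω : Ω} (hM : B ≤ sampleMoment X 1 n ω) :
    upperMoment X h n ω / sampleMoment X 1 n ω ^ h ≤
      η + C * ((n:ℝ)⁻¹ * ∑ i ∈ Finset.range n, if B < X i ω then (1:ℝ) else 0) := by
  set M := sampleMoment X 1 n ω with hMdef
  have hM0 : 0 < M := hB.trans_le hM
  have hMe : M = (n:ℝ)⁻¹ * ∑ i ∈ Finset.range n, X i ω := by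
    rw [hMdef, sampleMoment]; simp
  rw [div_le_iff₀ (by positivity)]
  have key : ∀ i, max (X i ω - M) 0 ^ h ≤
      M ^ h * (η * (X i ω / M) + C * if B < X i ω then (1:ℝ) else 0) := by
    intro i
    have hx := hXnn i ω
    rcases le_or_gt (X i ω) M with h1 | h1
    · rw [max_eq_right (by linarith), Real.zero_rpow hh.ne']
      split_ifs <;> positivity
    · rw [max_eq_left (by linarith), if_pos (by linarith), mul_one]
      calc (X i ω - M) ^ h ≤ (X i ω) ^ h := Real.rpow_le_rpow (by linarith) (by linarith) hh.le
        _ = M ^ h * (X i ω / M) ^ h := by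
            rw [← Real.mul_rpow hM0.le (by positivity), mul_div_cancel₀ _ hM0.ne']
        _ ≤ _ := by
            gcongr
            exact hy _ (by positivity)
  calc upperMoment X h n ω ≤ (n:ℝ)⁻¹ * ∑ i ∈ Finset.range n,
        M ^ h * (η * (X i ω / M) + C * if B < X i ω then (1:ℝ) else 0) := by
        unfold upperMoment
        gcongr with i _
        exact key i
    _ = M ^ h * (η * (((n:ℝ)⁻¹ * ∑ i ∈ Finset.range n, X i ω) / M) +
          C * ((n:ℝ)⁻¹ * ∑ i ∈ Finset.range n, if B < X i ω then (1:ℝ) else 0)) := by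
        rw [← Finset.mul_sum, Finset.sum_add_distrib, ← Finset.mul_sum, ← Finset.mul_sum,
          ← Finset.sum_div]
        ring
    _ = _ := by rw [← hMe, div_self hM0.ne']; ring

lemma sum_rpow_le {ι : Type*} (s : Finset ι) {f : ι → ℝ} (hf : ∀ i, 0 ≤ f i) {h : ℝ} (hh : 1 ≤ h) :
    ∑ i ∈ s, f i ^ h ≤ (∑ i ∈ s, f i) ^ h := by
  classical
  induction s using Finset.induction_on with
  | empty => simp [Real.zero_rpow (by linarith : h ≠ 0)]
  | insert a s ha ih =>
    rw [Finset.sum_insert ha, Finset.sum_insert ha]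
    refine le_trans (by gcongr) (Real.add_rpow_le_rpow_add (hf a) (Finset.sum_nonneg fun i _ => hf i) hh)

lemma add_rpow_le_two {a b h : ℝ} (ha : 0 ≤ a) (hb : 0 ≤ b) (hh : 0 < h) :
    (a + b) ^ h ≤ 2 ^ h * (a ^ h + b ^ h) := by
  have h1 : (a + b) ^ h ≤ (2 * max a b) ^ h :=
    Real.rpow_le_rpow (by positivity) (by linarith [le_max_left a b, le_max_right a b]) hh.le
  rw [Real.mul_rpow (by norm_num) (ha.trans (le_max_left _ _))] at h1
  refine h1.trans ?_
  have := Real.rpow_nonneg ha h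
  have := Real.rpow_nonneg hb h
  gcongr
  rcases max_choice a b with e | e <;> rw [e] <;> linarith

/-- deterministic bounds for part (b) -/
lemma det_b {Ω : Type*} {X : ℕ → Ω → ℝ} (hXnn : ∀ i ω, 0 ≤ X i ω) {h : ℝ} (hh : 1 < h)
    {n : ℕ} {ω : Ω} {v t : ℝ} (hn : 0 < n) (hv : 0 < v) (ht : 0 < t)
    (hup : ∑ i ∈ Finset.range n, X i ω ≤ t)
    (hlow : 2 ^ (h + 1) * v ^ h ≤ ∑ i ∈ Finset.range n, X i ω ^ h)
    (hvt : (n:ℝ) * (t / n) ^ h ≤ v ^ h) :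
    (Real.log v - Real.log n ≤ Real.log (sampleMoment X 1 n ω) ∧
      Real.log (sampleMoment X 1 n ω) ≤ Real.log t - Real.log n) ∧
    (h * Real.log v - Real.log n ≤ Real.log (upperMoment X h n ω) ∧
      Real.log (upperMoment X h n ω) ≤ h * Real.log t - Real.log n) := by
  have hn' : (0:ℝ) < n := by exact_mod_cast hn
  have hh0 : 0 < h := by linarith
  set S := ∑ i ∈ Finset.range n, X i ω with hS
  have hS0 : 0 ≤ S := Finset.sum_nonneg fun i _ => hXnn i ω
  set M := sampleMoment X 1 n ω with hMdef
  have hMe : M = S / n := by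
    rw [hMdef, sampleMoment]; simp [hS, div_eq_inv_mul]
  have hM0 : 0 ≤ M := by rw [hMe]; positivity
  have hSh : ∑ i ∈ Finset.range n, X i ω ^ h ≤ S ^ h := sum_rpow_le _ (fun i => hXnn i ω) hh.le
  have hvh : 0 < v ^ h := by positivity
  have h2 : (1:ℝ) ≤ 2 ^ (h + 1) := Real.one_le_rpow (by norm_num) (by linarith)
  have hvS : v ≤ S := by
    have : v ^ h ≤ S ^ h := by nlinarith
    exact (Real.rpow_le_rpow_iff hv.le hS0 hh0).1 this
  have hSp : 0 < S := hv.trans_le hvS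
  have hlogM : Real.log M = Real.log S - Real.log n := by
    rw [hMe, Real.log_div hSp.ne' hn'.ne']
  set U := ∑ i ∈ Finset.range n, max (X i ω - M) 0 ^ h with hU
  have hUM : upperMoment X h n ω = U / n := by
    rw [upperMoment, div_eq_inv_mul]
  have hUt : U ≤ t ^ h := by
    calc U ≤ ∑ i ∈ Finset.range n, X i ω ^ h := Finset.sum_le_sum fun i _ =>
          Real.rpow_le_rpow (le_max_right _ _) (max_le (by linarith) (hXnn i ω)) hh0.le
      _ ≤ S ^ h := hSh
      _ ≤ t ^ h := Real.rpow_le_rpow hS0 hup hh0.le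
  have hUv : v ^ h ≤ U := by
    have a1 : ∑ i ∈ Finset.range n, X i ω ^ h ≤ 2 ^ h * (U + n * M ^ h) := by
      calc _ ≤ ∑ i ∈ Finset.range n, 2 ^ h * (max (X i ω - M) 0 ^ h + M ^ h) :=
            Finset.sum_le_sum fun i _ => by
              refine le_trans ?_ (add_rpow_le_two (le_max_right _ _) hM0 hh0)
              refine Real.rpow_le_rpow (hXnn i ω) ?_ hh0.le
              linarith [le_max_left (X i ω - M) 0]
        _ = _ := by
            rw [← Finset.mul_sum, Finset.sum_add_distrib]; simp [hU]
    have a2 : n * M ^ h ≤ v ^ h := by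
      refine le_trans ?_ hvt
      have : M ≤ t / n := by rw [hMe]; gcongr
      gcongr
    have a3 : (2:ℝ) ^ (h + 1) = 2 ^ h * 2 := by rw [Real.rpow_add_one (by norm_num)]
    rw [a3] at hlow
    have a4 : 2 ^ h * (2 * v ^ h) ≤ 2 ^ h * (U + n * M ^ h) := by linarith
    have a5 := le_of_mul_le_mul_left a4 (by positivity)
    linarith
  have hUp : 0 < U := hvh.trans_le hUv
  have hlogU : Real.log (upperMoment X h n ω) = Real.log U - Real.log n := by
    rw [hUM, Real.log_div hUp.ne' hn'.ne']
  rw [hlogM, hlogU, ← Real.log_rpow hv, ← Real.log_rpow ht]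
  have b1 := Real.log_le_log hv hvS
  have b2 := Real.log_le_log hSp hup
  have b3 := Real.log_le_log hvh hUv
  have b4 := Real.log_le_log hUp hUt
  exact ⟨⟨by linarith, by linarith⟩, by linarith, by linarith⟩

lemma alg_b {α h C ρ L a lam lt lv lM lU : ℝ} (hα : 0 < α) (hα1 : α < 1) (hh : 1 < h)
    (hC : 0 < C) (hρ : 0 < ρ) (hL : 0 < L) (ha : 1 ≤ a)
    (h1 : |α * lt - (L + a + lam)| ≤ 1)
    (h2 : lt ≤ lv + C * a) (h3 : (1 + ρ) * L ≤ lv)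
    (m1 : lv - L ≤ lM) (m2 : lM ≤ lt - L) (u1 : h * lv - L ≤ lU) (u2 : lU ≤ h * lt - L) :
    |lU / lM - (h - α) / (1 - α)| ≤
      (((h + (h - α) / (1 - α)) * C + 2 * ((h - 1) / (1 - α))) / ρ) * ((a + |lam|) / L) := by
  set θ := (h - α) / (1 - α) with hθ
  set D := (h - 1) / (1 - α) with hD
  have h1a : 0 < 1 - α := by linarith
  have hθ0 : 0 < θ := div_pos (by linarith) h1a
  have hD0 : 0 < D := div_pos (by linarith) h1a
  have hMρ : ρ * L ≤ lM := by linarith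
  have hρL : 0 < ρ * L := by positivity
  have hM0 : 0 < lM := by linarith
  have e1 : lU / lM - θ = (lU - θ * lM) / lM := by field_simp
  have e2 : (h * lt - L) - θ * (lt - L) = - D * (α * lt - L) := by
    rw [hθ, hD]; field_simp; ring
  have hx : |α * lt - L| ≤ 2 * (a + |lam|) := by
    rw [abs_le] at h1 ⊢
    have := neg_abs_le lam
    have := le_abs_self lam
    have := abs_nonneg lam
    constructor <;> linarith
  have hN : |lU - θ * lM| ≤ ((h + θ) * C + 2 * D) * (a + |lam|) := by
    rw [abs_le] at hx
    have q1 : h * lt ≤ h * lv + h * (C * a) := by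
      have := mul_le_mul_of_nonneg_left h2 (show 0 ≤ h by linarith); linarith
    have q2 : θ * (lt - L) - θ * (C * a) ≤ θ * lM := by
      have := mul_le_mul_of_nonneg_left (show lt - L - C * a ≤ lM by linarith) hθ0.le; linarith
    have q3 : θ * lM ≤ θ * (lt - L) := mul_le_mul_of_nonneg_left m2 hθ0.le
    have q4 := mul_le_mul_of_nonneg_left hx.1 hD0.le
    have q5 := mul_le_mul_of_nonneg_left hx.2 hD0.le
    have q6 : 0 ≤ (h + θ) * C * |lam| := by positivity
    have q7 : 0 ≤ h * (C * a) := by positivity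
    have q8 : 0 ≤ θ * (C * a) := by positivity
    rw [abs_le]
    constructor <;> nlinarith
  rw [e1, abs_div, abs_of_pos hM0, div_le_iff₀ hM0]
  refine hN.trans ?_
  have hE : 0 ≤ ((h + θ) * C + 2 * D) * (a + |lam|) := by positivity
  calc _ = ((h + θ) * C + 2 * D) / ρ * ((a + |lam|) / L) * (ρ * L) := by field_simp
    _ ≤ _ := by gcongr

lemma part_a {Ω : Type*} [MeasurableSpace Ω] {μ : Measure Ω} [IsProbabilityMeasure μ]
    {X : ℕ → Ω → ℝ} (hXmeas : ∀ i, Measurable (X i)) (hXnn : ∀ i ω, 0 ≤ X i ω)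
    {h : ℝ} (hh0 : 0 < h) (hh1 : h < 1) {G : ℝ → ℝ} (hGpos : ∀ x, 0 < x → 0 < G x)
    (hs : ∀ i, ∀ x : ℝ, 0 < x → (μ {ω | x < X i ω}).toReal = G x)
    {c t v : ℕ → ℝ} (hc : ∀ n, 0 < c n) (hctop : Tendsto c atTop atTop)
    (hnctop : Tendsto (fun n : ℕ => (n : ℝ) * c n) atTop atTop)
    (ht : Tendsto (fun n : ℕ => (n : ℝ) * c n * G (t n)) atTop (nhds 1))
    (htpos : ∀ n, 0 < t n) (hvpos : ∀ n, 0 < v n) {ρ : ℝ} (hρ : 0 < ρ)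
    (hvlog : ∀ᶠ n : ℕ in atTop, (1 + ρ) * Real.log n ≤ Real.log (v n))
    {κ : ℝ} (hκ : 0 < κ)
    (hlow : Tendsto (fun n : ℕ =>
      μ.real {ω | ∑ i ∈ Finset.range n, X i ω ^ (1:ℝ) < κ * (v n ^ (1:ℝ) * c n)}) atTop (nhds 0)) :
    TendstoInProbability μ
        (fun n ω => upperMoment X h n ω / sampleMoment X 1 n ω ^ h) 0 := by
  intro ε hε
  obtain ⟨C, hC, hy⟩ := young_aux hh0 hh1 (half_pos hε)
  rw [Metric.tendsto_atTop']
  suffices H : ∀ δ > 0, ∀ᶠ n : ℕ in atTop,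
      μ.real {ω | ε < |upperMoment X h n ω / sampleMoment X 1 n ω ^ h - 0|} < δ by
    intro δ hδ
    obtain ⟨N, hN⟩ := eventually_atTop.1 (H δ hδ)
    refine ⟨N, fun n hn => ?_⟩
    rw [Real.dist_eq, sub_zero, abs_of_nonneg ENNReal.toReal_nonneg]
    exact hN n hn.le
  intro δ hδ
  have hG0 : Tendsto (fun n => G (t n)) atTop (nhds 0) := by
    have := ht.mul (tendsto_inv_atTop_zero.comp hnctop)
    rw [mul_zero] at this
    refine this.congr' ?_
    filter_upwards [eventually_gt_atTop 0] with n hn0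
    have hn0' : (n:ℝ) ≠ 0 := by exact_mod_cast hn0.ne'
    have := (hc n).ne'
    simp only [Function.comp]
    field_simp
  obtain ⟨m, hm⟩ := (hG0.eventually_lt_const (show 0 < δ / 2 * (ε / 2 / C) by positivity)).exists
  obtain ⟨B, hBdef⟩ : ∃ B, B = t m := ⟨_, rfl⟩
  rw [← hBdef] at hm
  have hB : 0 < B := hBdef ▸ htpos m
  filter_upwards [hlow.eventually_lt_const (half_pos hδ), eventually_gt_atTop 0, hvlog,
    hctop.eventually_ge_atTop (B / κ), logn_top.eventually_gt_atTop 0] with n h1 hn0 h2 h3 h4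
  have hn' : (0:ℝ) < n := by exact_mod_cast hn0
  set N : Ω → ℝ := fun ω => (n:ℝ)⁻¹ * ∑ i ∈ Finset.range n, if B < X i ω then (1:ℝ) else 0 with hN
  have hNe : N = fun ω => (n:ℝ)⁻¹ * ∑ i ∈ Finset.range n,
      Set.indicator {ω | B < X i ω} (fun _ => (1:ℝ)) ω := by
    ext ω; simp [hN, Set.indicator_apply]
  have hms : ∀ i, MeasurableSet {ω | B < X i ω} := fun i => measurableSet_lt measurable_const (hXmeas i)
  have hii : ∀ i, Integrable (Set.indicator {ω | B < X i ω} (fun _ => (1:ℝ))) μ := fun i =>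
    (integrable_const _).indicator (hms i)
  have hNi : Integrable N μ := by
    rw [hNe]; exact (integrable_finsetSum _ fun i _ => hii i).const_mul _
  have hNint : ∫ ω, N ω ∂μ = G B := by
    rw [hNe, integral_const_mul, integral_finsetSum _ fun i _ => hii i]
    have : ∀ i, ∫ ω, Set.indicator {ω | B < X i ω} (fun _ => (1:ℝ)) ω ∂μ = G B := fun i => by
      rw [integral_indicator_const _ (hms i), ← hs i B hB]; simp [Measure.real]
    simp only [this]
    simp
    field_simp
  have hNnn : ∀ ω, 0 ≤ N ω := fun ω => by
    simp only [hN]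
    refine mul_nonneg (by positivity) (Finset.sum_nonneg fun i _ => ?_)
    split_ifs <;> norm_num
  have hmk := mul_meas_ge_le_integral_of_nonneg (Eventually.of_forall hNnn) hNi (ε / 2 / C)
  rw [hNint] at hmk
  have hmk2 : μ.real {ω | ε / 2 / C ≤ N ω} < δ / 2 := by
    have h0 : 0 < ε / 2 / C := by positivity
    by_contra hcon
    push Not at hcon
    have := mul_le_mul_of_nonneg_left hcon h0.le
    linarith
  have hsub : {ω | ε < |upperMoment X h n ω / sampleMoment X 1 n ω ^ h - 0|} ⊆
      {ω | ∑ i ∈ Finset.range n, X i ω ^ (1:ℝ) < κ * (v n ^ (1:ℝ) * c n)} ∪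
      {ω | ε / 2 / C ≤ N ω} := by
    intro ω hω
    by_contra hcon
    simp only [Set.mem_union, Set.mem_ofPred_eq, not_or, not_lt, not_le, Real.rpow_one] at hcon hω
    obtain ⟨g1, g2⟩ := hcon
    have hvn : (n:ℝ) ≤ v n := by
      rw [← Real.log_le_log_iff hn' (hvpos n)]
      nlinarith
    have hMB : B ≤ sampleMoment X 1 n ω := by
      simp only [sampleMoment, Real.rpow_one]
      rw [← div_eq_inv_mul, le_div_iff₀ hn']
      refine le_trans ?_ g1
      rw [div_le_iff₀ hκ] at h3
      calc B * n ≤ (c n * κ) * v n := by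
            have := hc n
            gcongr
        _ = _ := by ring
    have hb := ratio_bound hXnn hh0 (half_pos hε) hC hy hB hMB
    have hnn : 0 ≤ upperMoment X h n ω / sampleMoment X 1 n ω ^ h := by
      refine div_nonneg ?_ (Real.rpow_nonneg (hB.le.trans hMB) _)
      exact mul_nonneg (by positivity) (Finset.sum_nonneg fun i _ => Real.rpow_nonneg (le_max_right _ _) _)
    rw [sub_zero, abs_of_nonneg hnn] at hω
    rw [lt_div_iff₀ hC] at g2
    simp only [hN] at g2
    linarith
  calc _ ≤ _ := measureReal_mono hsub
    _ ≤ _ := measureReal_union_le _ _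
    _ < δ / 2 + δ / 2 := add_lt_add h1 hmk2
    _ = δ := by ring

/-- **Theorem (h-th central upper moments).** -/
theorem central_upper_moments
    {Ω : Type*} [MeasurableSpace Ω] (μ : Measure Ω) [IsProbabilityMeasure μ]
    (X : ℕ → Ω → ℝ) (hXmeas : ∀ i, Measurable (X i)) (hXnn : ∀ i ω, 0 ≤ X i ω)
    (α : ℝ) (hα : 0 < α) (hα1 : α < 1)
    (l : ℝ → ℝ) (hlpos : ∀ x : ℝ, 0 < x → 0 < l x) (hl : SlowlyVarying l)
    (hsurv : ∀ i, ∀ x : ℝ, 0 < x → (μ {ω | x < X i ω}).toReal = x ^ (-α) * l x)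
    (c : ℕ → ℝ) (hc : ∀ n, 0 < c n) (hctop : Tendsto c atTop atTop)
    (hncmono : Monotone fun n : ℕ => (n : ℝ) * c n)
    (hnctop : Tendsto (fun n : ℕ => (n : ℝ) * c n) atTop atTop)
    (hclog : Tendsto (fun n : ℕ => Real.log (c n) / Real.log n) atTop (nhds 0))
    (t : ℕ → ℝ) (htpos : ∀ n, 0 < t n)
    (ht : Tendsto (fun n : ℕ => (n : ℝ) * c n * l (t n) / t n ^ α) atTop (nhds 1))
    (v : ℕ → ℝ) (hvpos : ∀ n, 0 < v n)
    (hv : Tendsto (fun n : ℕ => (n : ℝ) * l (v n) / (v n ^ α * c n)) atTop (nhds 1)) :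
    -- part (a)
    ((∀ h : ℝ, α < h → h < 1 →
      ConditionA μ X v c 1 → ConditionA μ X v c h →
      ∀ δ' : ℝ, 2 * (1 / α - 1) < δ' →
      Tendsto (fun n =>
        (∑ i ∈ Finset.range n, ∑ j ∈ Finset.range n,
          if i = j then 0
          else cov μ
            (fun ω => if X i ω ≤ (∫ ω', trunc (X 0) (t n) ω' ∂μ) / c n ^ (2 * δ')
              then (1 : ℝ) else 0)
            (fun ω => if X j ω ≤ (∫ ω', trunc (X 0) (t n) ω' ∂μ) / c n ^ (2 * δ')
              then (1 : ℝ) else 0)) / (n : ℝ) ^ 2)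
        atTop (nhds 0) →
      TendstoInProbability μ
        (fun n ω => upperMoment X h n ω / sampleMoment X 1 n ω ^ h) 0) ∧
    -- part (b)
    (∀ h : ℝ, 1 < h → ConditionA μ X v c h →
      IsOp μ (fun n ω =>
          Real.log (upperMoment X h n ω) / Real.log (sampleMoment X 1 n ω) -
            (h - α) / (1 - α))
        (fun n => (Real.log (c n) + |Real.log (l (t n))|) / Real.log n))) := by
  set G : ℝ → ℝ := fun x => x ^ (-α) * l x with hGdef
  have hG : ∀ x, 0 < x → G x = x ^ (-α) * l x := fun x _ => rfl
  have hGpos : ∀ x, 0 < x → 0 < G x := fun x hx =>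
    mul_pos (Real.rpow_pos_of_pos hx _) (hlpos x hx)
  have hs : ∀ i, ∀ x : ℝ, 0 < x → (μ {ω | x < X i ω}).toReal = G x := hsurv
  have hGanti : ∀ x y, 0 < x → x ≤ y → G y ≤ G x := by
    intro x y hx hxy
    rw [← hs 0 x hx, ← hs 0 y (hx.trans_le hxy)]
    refine ENNReal.toReal_mono (measure_ne_top _ _) (measure_mono fun ω hω => ?_)
    exact lt_of_le_of_lt hxy hω
  have hv' : Tendsto (fun n : ℕ => (n : ℝ) * G (v n) / c n) atTop (nhds 1) := by
    refine hv.congr fun n => ?_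
    simp only [hGdef]
    rw [Real.rpow_neg (hvpos n).le]
    have := (hc n).ne'
    have := (Real.rpow_pos_of_pos (hvpos n) α).ne'
    field_simp
  have ht' : Tendsto (fun n : ℕ => (n : ℝ) * c n * G (t n)) atTop (nhds 1) := by
    refine ht.congr fun n => ?_
    simp only [hGdef]
    rw [Real.rpow_neg (htpos n).le]
    have := (Real.rpow_pos_of_pos (htpos n) α).ne'
    field_simp
  have hvtop := v_top hGpos hGanti hc hclog hvpos hv'
  have httop := t_top hGpos hGanti hc hnctop htpos ht'
  obtain ⟨ρ, hρ, hvlog⟩ := v_log hα hα1 hlpos hl hG hGpos hGanti hc hclog hvpos hv'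
  have hlogc : Tendsto (fun n => Real.log (c n)) atTop atTop := Real.tendsto_log_atTop.comp hctop
  constructor
  · intro h hαh hh1 hA1 _ δ' _ _
    obtain ⟨κ, hκ, hlow⟩ := cheb hXmeas hXnn hα hlpos hl hG hGpos hGanti hs hc hctop hvpos hvtop hv' hα1 hA1
    exact part_a hXmeas hXnn (hα.trans hαh) hh1 hGpos hs hc hctop hnctop ht' htpos hvpos hρ hvlog hκ hlow
  · intro h hh hA
    obtain ⟨κ, hκ, hlow⟩ := cheb hXmeas hXnn hα hlpos hl hG hGpos hGanti hs hc hctop hvpos hvtop hv'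
      (hα1.trans hh) hA
    have hup := sum_upper hXmeas hXnn hα hα1 hlpos hl hG hGpos hGanti hs hc hctop htpos httop ht'
    obtain ⟨C, hC, htv⟩ := tv_log hα hlpos hl hG hGpos hGanti hc hctop hclog hvpos hv' htpos ht'
    have hlt : ∀ᶠ n : ℕ in atTop,
        |α * Real.log (t n) - (Real.log n + Real.log (c n) + Real.log (l (t n)))| ≤ 1 := by
      have h1 := ((Real.continuousAt_log one_ne_zero).tendsto.comp ht')
      rw [Real.log_one] at h1
      have h2 := h1.abs
      rw [abs_zero] at h2
      filter_upwards [h2.eventually_lt_const one_pos, eventually_gt_atTop 0] with n hn hn0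
      have hn0' : (n:ℝ) ≠ 0 := by exact_mod_cast hn0.ne'
      simp only [Function.comp, hGdef] at hn
      rw [Real.log_mul (mul_ne_zero hn0' (hc n).ne') (hGpos _ (htpos n)).ne',
        Real.log_mul hn0' (hc n).ne',
        Real.log_mul (Real.rpow_pos_of_pos (htpos n) _).ne' (hlpos _ (htpos n)).ne',
        Real.log_rpow (htpos n)] at hn
      rw [abs_sub_comm]
      refine le_trans (le_of_eq ?_) hn.le
      congr 1; ring
    set Q := (((h + (h - α) / (1 - α)) * C + 2 * ((h - 1) / (1 - α))) / ρ) with hQ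
    have hQ0 : 0 < Q := by
      have : 0 < (h - α) / (1 - α) := div_pos (by linarith) (by linarith)
      have : 0 < (h - 1) / (1 - α) := div_pos (by linarith) (by linarith)
      have : 0 < h := by linarith
      positivity
    intro ε hε
    refine ⟨Q, hQ0, ?_⟩
    have hsum := hup.add hlow
    rw [add_zero] at hsum
    have hη : 0 < (h - 1) / (h * C) := div_pos (by linarith) (mul_pos (by linarith) hC)
    filter_upwards [hsum.eventually_lt_const hε, hlt, htv, hvlog, eventually_gt_atTop 0,
      logn_top.eventually_gt_atTop 0, hlogc.eventually_ge_atTop 1, logc_le hclog hη,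
      hctop.eventually_ge_atTop (2 ^ (h + 1) / κ)] with n e1 e2 e3 e4 hn0 e5 e6 e7 e8
    refine lt_of_le_of_lt ?_ e1
    refine le_trans ?_ (measureReal_union_le _ _)
    refine measureReal_mono fun ω hω => ?_
    by_contra hcon
    simp only [Set.mem_union, Set.mem_ofPred_eq, not_or, not_lt] at hcon hω
    obtain ⟨g1, g2⟩ := hcon
    have hn0' : (0:ℝ) < n := by exact_mod_cast hn0
    have hvn := hvpos n
    have htn := htpos n
    have hh0 : 0 < h := by linarith
    have g3 : 2 ^ (h + 1) * v n ^ h ≤ ∑ i ∈ Finset.range n, X i ω ^ h := by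
      refine le_trans ?_ g2
      rw [div_le_iff₀ hκ] at e8
      have : 0 < v n ^ h := by positivity
      nlinarith
    have g4 : (n:ℝ) * (t n / n) ^ h ≤ v n ^ h := by
      rw [← Real.log_le_log_iff (by positivity) (by positivity),
        Real.log_mul (by positivity) (by positivity), Real.log_rpow (by positivity),
        Real.log_rpow (by positivity), Real.log_div htn.ne' hn0'.ne']
      have k1 := mul_le_mul_of_nonneg_left e3.2 hh0.le
      have k2 : h * C * Real.log (c n) ≤ (h - 1) * Real.log n := by
        have := mul_le_mul_of_nonneg_left e7 (mul_pos hh0 hC).le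
        rwa [← mul_assoc, mul_div_cancel₀ _ (mul_pos hh0 hC).ne'] at this
      linarith
    obtain ⟨⟨m1, m2⟩, u1, u2⟩ := det_b hXnn hh hn0 hvn htn g1 g3 g4
    have := alg_b hα hα1 hh hC hρ e5 e6 e2 e3.2 e4 m1 m2 u1 u2
    exact absurd hω (not_lt.2 this)
end
end
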